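/- Nonnegativity and symmetry of the Berry curvature for a four-fold degenerate flat band: In the setting of the two-fold degenerate Gramian (see context), g(k) > 0 for every k ∈ ℂ∖Λ*, and the function H(k) := ∂_k̄ ∂_k log g(k) satisfies, for every k ∈ ℂ∖Λ*: H(k) ≥ 0, H(ωk) = H(k), and H(−k) = H(k). (H is the trace of the curvature of the Chern connection of the rank-two flat-band bundle.) -/

import Mathlib

noncomputable section

open Complex MeasureTheory

namespace TBG

/-- `ω = exp(2πi/3)`. -/
def ω : ℂ := Complex.exp (2 * Real.pi * Complex.I / 3)

/-- The moiré lattice `Λ = ℤω + ℤ ⊂ ℂ`. -/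
def Λ : Set ℂ := {z : ℂ | ∃ m n : ℤ, z = m * ω + n}

/-- The dual lattice `Λ* = (4πi/√3)·Λ`. -/
def Λdual : Set ℂ := {p : ℂ | ∃ m n : ℤ, p = 4 * Real.pi * Complex.I / Real.sqrt 3 * (m * ω + n)}

/-- The high symmetry point `K = 4π/3`. -/
def K : ℂ := 4 * Real.pi / 3

/-- `⟨z,w⟩ = Re (z · conj w)`. -/
def pair (z w : ℂ) : ℝ := (z * (starRingEnd ℂ) w).re

/-- `2 D_z̄ f = (1/i)(∂_x f + i ∂_y f)`. -/
def Dbar (f : ℂ → ℂ) (z : ℂ) : ℂ :=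
  1 / Complex.I * (fderiv ℝ f z 1 + Complex.I * fderiv ℝ f z Complex.I)

/-- A tunnelling potential: smooth, with the translational and rotational symmetries. -/
def IsTunnelling (U : ℂ → ℂ) : Prop :=
  ContDiff ℝ (⊤ : ℕ∞) U ∧
    (∀ γ ∈ Λ, ∀ z : ℂ, U (z + γ) = Complex.exp (Complex.I * (pair γ K : ℂ)) * U z) ∧
    ∀ z : ℂ, U (ω * z) = ω * U z

/-- Membership in `ker_{L²₀}(D(α)+k)` for the chiral model with tunnelling
potentials `U₊ = Up`, `U₋ = Um`: smooth solutions of `(D(α)+k)u = 0` with the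
Floquet boundary conditions. -/
def InKer (Up Um : ℂ → ℂ) (α k : ℂ) (u : ℂ → ℂ × ℂ) : Prop :=
  ContDiff ℝ (⊤ : ℕ∞) u ∧
    (∀ z : ℂ, Dbar (fun w => (u w).1) z + k * (u z).1 + α * Up z * (u z).2 = 0) ∧
    (∀ z : ℂ, Dbar (fun w => (u w).2) z + k * (u z).2 + α * Um z * (u z).1 = 0) ∧
    (∀ γ ∈ Λ, ∀ z : ℂ, (u (z + γ)).1 = Complex.exp (-Complex.I * (pair γ K : ℂ)) * (u z).1) ∧
    (∀ γ ∈ Λ, ∀ z : ℂ, (u (z + γ)).2 = Complex.exp (Complex.I * (pair γ K : ℂ)) * (u z).2)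

/-- `Ker(α,k)` as a set of functions. -/
def kerSet (Up Um : ℂ → ℂ) (α k : ℂ) : Set (ℂ → ℂ × ℂ) := {u | InKer Up Um α k u}

/-- `dim_ℂ Ker(α,k)` (the set `Ker(α,k)` is a linear subspace, so the finrank of its span
is its dimension). -/
def kerDim (Up Um : ℂ → ℂ) (α k : ℂ) : ℕ :=
  Module.finrank ℂ ↥(Submodule.span ℂ (kerSet Up Um α k))

/-- `Ker_p(α) = {u ∈ Ker(α,0) : u(ωz) = ω^(−p)·u(z)}`. -/
def kerPSet (Up Um : ℂ → ℂ) (α : ℂ) (p : ℕ) : Set (ℂ → ℂ × ℂ) :=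
  {u | u ∈ kerSet Up Um α 0 ∧ ∀ z : ℂ, u (ω * z) = (ω ^ (-(p : ℤ))) • u z}

/-- `dim_ℂ Ker_p(α)`. -/
def kerPDim (Up Um : ℂ → ℂ) (α : ℂ) (p : ℕ) : ℕ :=
  Module.finrank ℂ ↥(Submodule.span ℂ (kerPSet Up Um α p))

/-- `α` is magic: the flat band condition `Ker(α,k) ≠ {0}` for every `k`. -/
def IsMagic (Up Um : ℂ → ℂ) (α : ℂ) : Prop :=
  ∀ k : ℂ, ∃ u ∈ kerSet Up Um α k, u ≠ 0


/-- The stacking point `z_S = i/√3`. -/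
def zS : ℂ := Complex.I / Real.sqrt 3

/-- Jacobi's theta function `θ₁(ζ|ω)`. -/
def theta (ζ : ℂ) : ℂ :=
  -∑' n : ℤ, Complex.exp (Real.pi * Complex.I * ((n : ℂ) + 1 / 2) ^ 2 * ω +
      2 * Real.pi * Complex.I * ((n : ℂ) + 1 / 2) * (ζ + 1 / 2))

/-- `z(k) = √3·k/(4πi)`. -/
def zmap (k : ℂ) : ℂ := Real.sqrt 3 * k / (4 * Real.pi * Complex.I)

/-- `F_k(z) = exp((i/2)(z−conj z)k)·θ(z−z(k))/θ(z)`. -/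
def Fk (k z : ℂ) : ℂ :=
  Complex.exp (Complex.I / 2 * (z - (starRingEnd ℂ) z) * k) * theta (z - zmap k) / theta z

/-- A fundamental domain of `Λ`: `{s + tω : s,t ∈ [0,1)}`. -/
def FΛ : Set ℂ := {z : ℂ | ∃ s t : ℝ, 0 ≤ s ∧ s < 1 ∧ 0 ≤ t ∧ t < 1 ∧ z = s + t * ω}

/-- The Wirtinger derivative `∂_k`. -/
def dk (f : ℂ → ℂ) (k : ℂ) : ℂ := (fderiv ℝ f k 1 - Complex.I * fderiv ℝ f k Complex.I) / 2

/-- The Wirtinger derivative `∂_k̄`. -/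
def dkbar (f : ℂ → ℂ) (k : ℂ) : ℂ := (fderiv ℝ f k 1 + Complex.I * fderiv ℝ f k Complex.I) / 2

/-! ### The cube root of unity -/

lemma ω_eq : ω = -1 / 2 + Real.sqrt 3 / 2 * I := by
  have h : (2 * Real.pi * I / 3 : ℂ) = ((Real.pi - Real.pi / 3 : ℝ) : ℂ) * I := by
    push_cast; ring
  rw [ω, h, exp_mul_I, ← ofReal_cos, ← ofReal_sin, Real.cos_pi_sub, Real.sin_pi_sub,
    Real.cos_pi_div_three, Real.sin_pi_div_three]
  push_cast; ring

lemma ω_re : ω.re = -1 / 2 := by rw [ω_eq]; simp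

lemma ω_im : ω.im = Real.sqrt 3 / 2 := by rw [ω_eq]; simp

lemma ω_im_pos : 0 < ω.im := by rw [ω_im]; positivity

lemma ω_sq : ω ^ 2 = -1 - ω := by
  have h : ((Real.sqrt 3 : ℝ) : ℂ) ^ 2 = 3 := by
    rw [← ofReal_pow, Real.sq_sqrt (by norm_num)]; norm_num
  rw [ω_eq]
  linear_combination (I ^ 2 / 4) * h + 3 / 4 * I_sq

lemma ω_ne_zero : ω ≠ 0 := by simp [ω]

lemma norm_ω : ‖ω‖ = 1 := by
  have h : (2 * Real.pi * I / 3 : ℂ) = ((2 * Real.pi / 3 : ℝ) : ℂ) * I := by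
    push_cast; ring
  rw [ω, h, norm_exp_ofReal_mul_I]

lemma conj_ω : (starRingEnd ℂ) ω = ω ^ 2 := by
  rw [ω_sq]
  apply Complex.ext
  · simp [ω_re]; norm_num
  · simp

lemma ω_mul_conj : ω * (starRingEnd ℂ) ω = 1 := by
  rw [mul_conj, normSq_eq_norm_sq, norm_ω]; norm_num

lemma inv_ω : ω⁻¹ = -1 - ω := by
  rw [← ω_sq, ← conj_ω]
  exact inv_eq_of_mul_eq_one_right ω_mul_conj

/-! ### The theta function -/

lemma theta_eq_jacobiTheta₂ (ζ : ℂ) :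
    theta ζ = -(cexp (Real.pi * I * ω / 4 + Real.pi * I * (ζ + 1 / 2)) *
      jacobiTheta₂ (ζ + 1 / 2 + ω / 2) ω) := by
  rw [theta, jacobiTheta₂, ← tsum_mul_left]
  congr 1
  refine tsum_congr fun n => ?_
  rw [jacobiTheta₂_term, ← Complex.exp_add]
  ring_nf

lemma hasSum_theta (ζ : ℂ) :
    HasSum (fun n : ℤ => cexp (Real.pi * I * ((n : ℂ) + 1 / 2) ^ 2 * ω +
      2 * Real.pi * I * ((n : ℂ) + 1 / 2) * (ζ + 1 / 2))) (-theta ζ) := by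
  have h := (hasSum_jacobiTheta₂_term (ζ + 1 / 2 + ω / 2) ω_im_pos).mul_left
    (cexp (Real.pi * I * ω / 4 + Real.pi * I * (ζ + 1 / 2)))
  rw [theta_eq_jacobiTheta₂, neg_neg]
  refine h.congr_fun fun n => ?_
  rw [jacobiTheta₂_term, ← Complex.exp_add]
  ring_nf

lemma differentiable_theta : Differentiable ℂ theta := by
  have h : theta = fun ζ => -(cexp (Real.pi * I * ω / 4 + Real.pi * I * (ζ + 1 / 2)) *
      jacobiTheta₂ (ζ + 1 / 2 + ω / 2) ω) := funext theta_eq_jacobiTheta₂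
  rw [h]
  intro ζ
  have h1 : DifferentiableAt ℂ (fun ζ : ℂ => jacobiTheta₂ (ζ + 1 / 2 + ω / 2) ω) ζ :=
    (differentiableAt_jacobiTheta₂_fst (ζ + 1 / 2 + ω / 2) ω_im_pos).comp ζ
      (f := fun ζ : ℂ => ζ + 1 / 2 + ω / 2) (by fun_prop)
  fun_prop

@[fun_prop]
lemma continuous_theta : Continuous theta := differentiable_theta.continuous

lemma theta_add (ζ : ℂ) (m l : ℤ) :
    theta (ζ + (m * ω + l)) =
      cexp (-Real.pi * I * m ^ 2 * ω - 2 * Real.pi * I * m * ζ - Real.pi * I * m +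
        Real.pi * I * l) * theta ζ := by
  conv_rhs => rw [theta, mul_neg, ← tsum_mul_left, ← (Equiv.addRight m).tsum_eq]
  rw [theta]
  congr 1
  refine tsum_congr fun n => ?_
  rw [← Complex.exp_add, Complex.exp_eq_exp_iff_exists_int]
  refine ⟨n * l, ?_⟩
  simp only [Equiv.coe_addRight]
  push_cast
  ring

lemma theta_neg (ζ : ℂ) : theta (-ζ) = -theta ζ := by
  conv_lhs => rw [theta, ← (Equiv.subLeft (-1 : ℤ)).tsum_eq]
  rw [theta, neg_inj, ← tsum_neg]
  refine tsum_congr fun n => ?_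
  have h1 : -cexp (Real.pi * I * ((n : ℂ) + 1 / 2) ^ 2 * ω +
      2 * Real.pi * I * ((n : ℂ) + 1 / 2) * (ζ + 1 / 2)) =
      cexp (Real.pi * I * ((n : ℂ) + 1 / 2) ^ 2 * ω +
      2 * Real.pi * I * ((n : ℂ) + 1 / 2) * (ζ + 1 / 2) + Real.pi * I) := by
    rw [Complex.exp_add _ (Real.pi * I), exp_pi_mul_I]; ring
  rw [h1, Complex.exp_eq_exp_iff_exists_int]
  refine ⟨-(n + 1), ?_⟩
  simp only [Equiv.subLeft_apply]
  push_cast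
  ring

lemma theta_zero : theta 0 = 0 := by
  have h := theta_neg 0
  rw [neg_zero] at h
  exact self_eq_neg.mp h

lemma jacobiTheta₂_add_one_right (z τ : ℂ) :
    jacobiTheta₂ z (τ + 1) = jacobiTheta₂ (z + 1 / 2) τ := by
  refine tsum_congr fun n => ?_
  rw [jacobiTheta₂_term, jacobiTheta₂_term, Complex.exp_eq_exp_iff_exists_int]
  obtain ⟨m, hm⟩ := Int.even_mul_pred_self n
  refine ⟨m, ?_⟩
  have hm' : (n : ℂ) * (n - 1) = m + m := by exact_mod_cast hm
  linear_combination (Real.pi * I : ℂ) * hm'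

lemma theta_ω_mul : ∃ c : ℂ, c ≠ 0 ∧ ∀ ζ : ℂ,
    theta (ω * ζ) = c * cexp (-Real.pi * I * ω * ζ ^ 2) * theta ζ := by
  refine ⟨1 / (-I * ω) ^ (1 / 2 : ℂ) * cexp (3 * Real.pi * I / 4), ?_, fun ζ => ?_⟩
  · refine mul_ne_zero (one_div_ne_zero ?_) (exp_ne_zero _)
    rw [Ne, cpow_eq_zero_iff]
    simp [ω_ne_zero]
  · have hinv : -1 / ω = ω + 1 := by
      rw [div_eq_mul_inv, inv_ω]; ring
    have hdiv : (ω * ζ + 1 / 2 + ω / 2) / ω + 1 / 2 = (ζ + 1 / 2 - ω / 2) := by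
      rw [div_eq_mul_inv, inv_ω]
      linear_combination (-ζ - 1 / 2) * ω_sq
    have hsq : -Real.pi * I * (ω * ζ + 1 / 2 + ω / 2) ^ 2 / ω =
        -Real.pi * I * (ω * ζ ^ 2 + (1 + ω) * ζ + 1 / 4) := by
      rw [div_eq_iff ω_ne_zero]
      linear_combination (-Real.pi * I / 4) * ω_sq
    have hshift : jacobiTheta₂ (ζ + 1 / 2 + ω / 2) ω =
        cexp (-Real.pi * I * (ω + 2 * (ζ + 1 / 2 - ω / 2))) *
          jacobiTheta₂ (ζ + 1 / 2 - ω / 2) ω := by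
      rw [← jacobiTheta₂_add_left']
      ring_nf
    rw [theta_eq_jacobiTheta₂, theta_eq_jacobiTheta₂, jacobiTheta₂_functional_equation,
      hsq, hinv, jacobiTheta₂_add_one_right, hdiv, hshift]
    have hexp : cexp (Real.pi * I * ω / 4 + Real.pi * I * (ω * ζ + 1 / 2)) *
        cexp (-Real.pi * I * (ω * ζ ^ 2 + (1 + ω) * ζ + 1 / 4)) =
        cexp (3 * Real.pi * I / 4) * cexp (-Real.pi * I * ω * ζ ^ 2) *
        cexp (Real.pi * I * ω / 4 + Real.pi * I * (ζ + 1 / 2)) *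
        cexp (-Real.pi * I * (ω + 2 * (ζ + 1 / 2 - ω / 2))) := by
      simp only [← Complex.exp_add]
      rw [Complex.exp_eq_exp_iff_exists_int]
      refine ⟨0, ?_⟩
      push_cast
      ring
    linear_combination (-(1 / (-I * ω) ^ (1 / 2 : ℂ)) *
      jacobiTheta₂ (ζ + 1 / 2 - ω / 2) ω) * hexp

lemma norm_odd_power_sum_le {x : ℂ} (hx : x ≠ 0) {R : ℝ} (hR : 1 ≤ R) (h1 : ‖x‖ ^ 2 ≤ R)
    (h2 : ‖x⁻¹‖ ^ 2 ≤ R) (n : ℕ) :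
    ‖x ^ (2 * n + 1) + x⁻¹ ^ (2 * n + 1)‖ ≤ ‖x + x⁻¹‖ * ((2 * n + 1) * R ^ n) := by
  induction n with
  | zero => simp
  | succ n ih =>
    have hxx : x * x⁻¹ = 1 := mul_inv_cancel₀ hx
    have hid : x ^ (2 * (n + 1) + 1) + x⁻¹ ^ (2 * (n + 1) + 1) =
        ((x ^ 2) ^ (n + 1) + (x⁻¹ ^ 2) ^ (n + 1)) * (x + x⁻¹) -
          (x ^ (2 * n + 1) + x⁻¹ ^ (2 * n + 1)) := by
      have e : ∀ y : ℂ, y ^ (2 * n + 1) = y ^ (2 * n) * y := fun y => pow_succ _ _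
      rw [← pow_mul, ← pow_mul, show 2 * (n + 1) + 1 = 2 * n + 1 + 1 + 1 by ring,
        show 2 * (n + 1) = 2 * n + 1 + 1 by ring]
      simp only [pow_succ _ (2 * n + 1), pow_succ _ (2 * n + 1 + 1)]
      linear_combination (-(x ^ (2 * n + 1) + x⁻¹ ^ (2 * n + 1))) * hxx
    have hb : ‖(x ^ 2) ^ (n + 1) + (x⁻¹ ^ 2) ^ (n + 1)‖ ≤ 2 * R ^ (n + 1) := by
      refine (norm_add_le _ _).trans ?_
      rw [norm_pow, norm_pow, norm_pow, norm_pow, two_mul]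
      gcongr
    have hRn : R ^ n ≤ R ^ (n + 1) := pow_le_pow_right₀ hR (Nat.le_succ n)
    rw [hid]
    calc _ ≤ _ := norm_sub_le _ _
      _ ≤ 2 * R ^ (n + 1) * ‖x + x⁻¹‖ + ‖x + x⁻¹‖ * ((2 * n + 1) * R ^ (n + 1)) := by
        rw [norm_mul]
        refine add_le_add (by gcongr) (ih.trans (by gcongr))
      _ = _ := by push_cast; ring

lemma hasSum_odd_mul_geometric_eighth :
    HasSum (fun n : ℕ => (2 * (n : ℝ) + 1) * (1 / 8) ^ n) (72 / 49) := by
  have h1 := hasSum_coe_mul_geometric_of_norm_lt_one (r := (1 / 8 : ℝ)) (by norm_num)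
  have h2 := hasSum_geometric_of_lt_one (r := (1 / 8 : ℝ)) (by norm_num) (by norm_num)
  have e : (72 / 49 : ℝ) = 2 * (1 / 8 / (1 - 1 / 8) ^ 2) + (1 - 1 / 8)⁻¹ := by norm_num
  rw [e]
  exact ((h1.mul_left 2).add h2).congr_fun fun n => by ring

lemma exp_neg_pi_mul_sqrt_three_le : Real.exp (-(Real.pi * Real.sqrt 3 / 2)) ≤ 1 / 8 := by
  have h3 : (1.7 : ℝ) ≤ Real.sqrt 3 := Real.le_sqrt_of_sq_le (by norm_num)
  have h4 := Real.pi_gt_three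
  have h5 : (2.5 : ℝ) ≤ Real.pi * Real.sqrt 3 / 2 := by nlinarith
  have h6 : (8 : ℝ) ≤ Real.exp 2.5 := by
    have e : Real.exp 2.5 = Real.exp 1 * Real.exp 1 * Real.exp 0.5 := by
      rw [← Real.exp_add, ← Real.exp_add]; norm_num
    have := Real.add_one_le_exp 0.5
    have := Real.exp_one_gt_d9
    rw [e]
    nlinarith
  rw [Real.exp_neg, one_div]
  exact inv_anti₀ (by norm_num) (h6.trans (Real.exp_le_exp.mpr h5))

lemma exists_int_of_theta_eq_zero {ζ : ℂ} (hζ : |ζ.im| ≤ Real.sqrt 3 / 4)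
    (h0 : theta ζ = 0) : ∃ l : ℤ, ζ = l := by
  set x : ℂ := cexp (Real.pi * I * (ζ + 1 / 2)) with hx
  set r : ℝ := Real.exp (-(Real.pi * Real.sqrt 3 / 2)) with hr
  have hr0 : 0 < r := Real.exp_pos _
  have hr8 : r ≤ 1 / 8 := exp_neg_pi_mul_sqrt_three_le
  have hx0 : x ≠ 0 := exp_ne_zero _
  have hnx : ‖x‖ ^ 2 ≤ r⁻¹ := by
    rw [hx, norm_exp, hr, ← Real.exp_neg, neg_neg, ← Real.exp_nat_mul]
    refine Real.exp_le_exp.mpr ?_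
    have := (abs_le.mp hζ).1
    have := Real.pi_pos
    simp
    nlinarith
  have hnx' : ‖x⁻¹‖ ^ 2 ≤ r⁻¹ := by
    rw [hx, ← Complex.exp_neg, norm_exp, hr, ← Real.exp_neg, neg_neg, ← Real.exp_nat_mul]
    refine Real.exp_le_exp.mpr ?_
    have := (abs_le.mp hζ).2
    have := Real.pi_pos
    simp
    nlinarith
  have hsum := (hasSum_theta ζ).nat_add_neg_add_one
  rw [h0, neg_zero] at hsum
  set q : ℕ → ℂ := fun n => cexp (Real.pi * I * ((n : ℂ) + 1 / 2) ^ 2 * ω) with hq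
  have hterm : ∀ n : ℕ, cexp (Real.pi * I * (((n : ℤ) : ℂ) + 1 / 2) ^ 2 * ω +
      2 * Real.pi * I * (((n : ℤ) : ℂ) + 1 / 2) * (ζ + 1 / 2)) +
      cexp (Real.pi * I * (((-((n : ℤ) + 1) : ℤ) : ℂ) + 1 / 2) ^ 2 * ω +
      2 * Real.pi * I * (((-((n : ℤ) + 1) : ℤ) : ℂ) + 1 / 2) * (ζ + 1 / 2)) =
      q n * (x ^ (2 * n + 1) + x⁻¹ ^ (2 * n + 1)) := by
    intro n
    rw [hx, ← Complex.exp_neg, ← Complex.exp_nat_mul, ← Complex.exp_nat_mul]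
    change _ = cexp _ * _
    rw [mul_add (cexp _), ← Complex.exp_add, ← Complex.exp_add]
    push_cast
    ring_nf
  simp only [hterm] at hsum
  have hnq : ∀ n : ℕ, ‖q n‖ = ‖q 0‖ * r ^ (n ^ 2 + n) := by
    intro n
    rw [hq, hr]
    simp only [norm_exp]
    rw [← Real.exp_nat_mul, ← Real.exp_add]
    congr 1
    have e : ∀ n : ℕ, (Real.pi * I * ((n : ℂ) + 1 / 2) ^ 2 * ω : ℂ).re =
        -(Real.pi * (n + 1 / 2) ^ 2 * (Real.sqrt 3 / 2)) := by
      intro n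
      have : (Real.pi * I * ((n : ℂ) + 1 / 2) ^ 2 * ω : ℂ) =
          ((Real.pi * (n + 1 / 2) ^ 2 : ℝ) : ℂ) * (I * ω) := by push_cast; ring
      rw [this, re_ofReal_mul]
      simp [ω_im]
    rw [e, e]
    push_cast
    ring
  have hbound : ∀ n : ℕ, ‖q n * (x ^ (2 * n + 1) + x⁻¹ ^ (2 * n + 1))‖ ≤
      ‖q 0‖ * ‖x + x⁻¹‖ * ((2 * n + 1) * (1 / 8) ^ n) := by
    intro n
    have h1 := norm_odd_power_sum_le hx0 (R := r⁻¹) (by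
      rw [one_le_inv₀ hr0]; linarith) hnx hnx' n
    have h2 : r ^ (n ^ 2 + n) * r⁻¹ ^ n ≤ (1 / 8) ^ n := by
      rw [pow_add, mul_assoc, ← mul_pow, mul_inv_cancel₀ hr0.ne', one_pow, mul_one]
      calc r ^ (n ^ 2) ≤ r ^ n := pow_le_pow_of_le_one hr0.le (by linarith) (by nlinarith)
        _ ≤ _ := by gcongr
    rw [norm_mul, hnq]
    calc _ ≤ ‖q 0‖ * r ^ (n ^ 2 + n) * (‖x + x⁻¹‖ * ((2 * n + 1) * r⁻¹ ^ n)) := by gcongr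
      _ = ‖q 0‖ * ‖x + x⁻¹‖ * (2 * n + 1) * (r ^ (n ^ 2 + n) * r⁻¹ ^ n) := by ring
      _ ≤ ‖q 0‖ * ‖x + x⁻¹‖ * (2 * n + 1) * (1 / 8) ^ n := by gcongr
      _ = _ := by ring
  have hzero : x + x⁻¹ = 0 := by
    by_contra hne
    have hC : 0 < ‖q 0‖ * ‖x + x⁻¹‖ :=
      mul_pos (norm_pos_iff.mpr (exp_ne_zero _)) (norm_pos_iff.mpr hne)
    have hg := hasSum_odd_mul_geometric_eighth.mul_left (‖q 0‖ * ‖x + x⁻¹‖)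
    have hg1 := (hasSum_nat_add_iff' 1).mpr hg
    have hs1 := (hasSum_nat_add_iff' 1).mpr hsum
    have := tsum_of_norm_bounded hg1 (fun n => hbound (n + 1))
    rw [hs1.tsum_eq] at this
    simp only [Finset.range_one, Finset.sum_singleton, zero_sub, norm_neg] at this
    simp at this
    nlinarith
  have hx2 : cexp (2 * Real.pi * I * ζ) = 1 := by
    have h1 : x * x = -1 := by
      have := mul_inv_cancel₀ hx0
      linear_combination x * hzero - this
    have h2 : x * x = cexp (2 * Real.pi * I * ζ) * cexp (Real.pi * I) := by
      rw [hx, ← Complex.exp_add, ← Complex.exp_add]; ring_nf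
    rw [exp_pi_mul_I] at h2
    linear_combination h2 - h1
  obtain ⟨l, hl⟩ := Complex.exp_eq_one_iff.mp hx2
  exact ⟨l, mul_left_cancel₀ two_pi_I_ne_zero (hl.trans (mul_comm _ _))⟩

lemma theta_add_of_mem {γ : ℂ} (hγ : γ ∈ Λ) : ∃ a b : ℂ, ∀ ζ : ℂ,
    theta (ζ + γ) = cexp (a * ζ + b) * theta ζ := by
  obtain ⟨m, l, rfl⟩ := hγ
  refine ⟨-2 * Real.pi * I * m, -Real.pi * I * m ^ 2 * ω - Real.pi * I * m + Real.pi * I * l,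
    fun ζ => ?_⟩
  rw [theta_add]
  ring_nf

lemma theta_eq_zero_iff {ζ : ℂ} : theta ζ = 0 ↔ ζ ∈ Λ := by
  constructor
  · intro h
    have h3 : 0 < Real.sqrt 3 := by positivity
    set m : ℤ := round (ζ.im / (Real.sqrt 3 / 2)) with hm
    have hz : theta (ζ + ((-m : ℤ) * ω + (0 : ℤ))) = 0 := by rw [theta_add, h, mul_zero]
    obtain ⟨l, hl⟩ := exists_int_of_theta_eq_zero (by
      have h1 := abs_sub_round (ζ.im / (Real.sqrt 3 / 2))
      rw [← hm] at h1
      have h2 : (ζ + ((-m : ℤ) * ω + (0 : ℤ))).im =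
          (ζ.im / (Real.sqrt 3 / 2) - m) * (Real.sqrt 3 / 2) := by
        simp [ω_im]; field_simp; ring
      rw [h2, abs_mul, abs_of_pos (by positivity : 0 < Real.sqrt 3 / 2)]
      nlinarith) hz
    refine ⟨m, l, ?_⟩
    push_cast at hl
    linear_combination hl
  · intro h
    obtain ⟨a, b, hab⟩ := theta_add_of_mem h
    have := hab 0
    rwa [zero_add, theta_zero, mul_zero] at this

/-! ### The lattice and its fundamental domain -/

lemma add_mem_Λ {a b : ℂ} (ha : a ∈ Λ) (hb : b ∈ Λ) : a + b ∈ Λ := by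
  obtain ⟨m, n, rfl⟩ := ha
  obtain ⟨m', n', rfl⟩ := hb
  exact ⟨m + m', n + n', by push_cast; ring⟩

lemma neg_mem_Λ {a : ℂ} (ha : a ∈ Λ) : -a ∈ Λ := by
  obtain ⟨m, n, rfl⟩ := ha
  exact ⟨-m, -n, by push_cast; ring⟩

lemma neg_mem_Λ_iff {a : ℂ} : -a ∈ Λ ↔ a ∈ Λ :=
  ⟨fun h => by simpa using neg_mem_Λ h, neg_mem_Λ⟩

lemma ω_mul_mem_Λ {a : ℂ} (ha : a ∈ Λ) : ω * a ∈ Λ := by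
  obtain ⟨m, n, rfl⟩ := ha
  exact ⟨n - m, -m, by push_cast; linear_combination (m : ℂ) * ω_sq⟩

lemma ω_mul_mem_Λ_iff {a : ℂ} : ω * a ∈ Λ ↔ a ∈ Λ := by
  refine ⟨fun h => ?_, ω_mul_mem_Λ⟩
  have := ω_mul_mem_Λ (ω_mul_mem_Λ h)
  have e : ω * (ω * (ω * a)) = a := by linear_combination (a * (ω - 1)) * ω_sq
  rwa [e] at this

lemma countable_Λ : Λ.Countable := by
  have : Λ = Set.range (fun p : ℤ × ℤ => (p.1 * ω + p.2 : ℂ)) := by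
    ext z
    simp only [Λ, Set.mem_ofPred_eq, Set.mem_range, Prod.exists, eq_comm]
  rw [this]
  exact Set.countable_range _

lemma two_mul_zS_not_mem : 2 * zS ∉ Λ := by
  rintro ⟨m, n, h⟩
  have h3 : 0 < Real.sqrt 3 := by positivity
  have hs : Real.sqrt 3 * Real.sqrt 3 = 3 := Real.mul_self_sqrt (by norm_num)
  have him := congrArg im h
  have e : (2 * zS).im = 2 / Real.sqrt 3 := by
    rw [zS, show 2 * (I / (Real.sqrt 3 : ℂ)) = ((2 / Real.sqrt 3 : ℝ) : ℂ) * I by push_cast; ring]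
    simp
  rw [e] at him
  simp only [add_im, mul_im, intCast_re, intCast_im, ω_im, zero_mul, add_zero] at him
  field_simp at him
  have : (4 : ℝ) = m * 3 := by
    nlinarith
  have : (4 : ℤ) = m * 3 := by exact_mod_cast this
  omega

lemma ω_mul_zS : ω * zS = zS + ((-1 : ℤ) * ω + (-1 : ℤ)) := by
  have h3 : (Real.sqrt 3 : ℂ) ≠ 0 := by simp
  have hs : (Real.sqrt 3 : ℂ) ^ 2 = 3 := by
    rw [← ofReal_pow, Real.sq_sqrt (by norm_num)]; norm_num
  rw [zS, ω_eq]
  field_simp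
  push_cast
  linear_combination I * hs + (Real.sqrt 3 : ℂ) * I_sq

/-- The real basis `(1, ω)` of `ℂ`. -/
def latticeBasis : Module.Basis (Fin 2) ℝ ℂ :=
  basisOfLinearIndependentOfCardEqFinrank (b := ![1, ω]) (by
    rw [LinearIndependent.pair_iff]
    intro s t h
    have h1 := congrArg im h
    have h2 := congrArg re h
    have h3 := ω_im_pos.ne'
    simp [h3] at h1
    simpa [h1] using h2) (by simp [finrank_real_complex])

lemma coe_latticeBasis : ⇑latticeBasis = ![1, ω] :=
  coe_basisOfLinearIndependentOfCardEqFinrank _ _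

lemma mem_span_latticeBasis {z : ℂ} :
    z ∈ Submodule.span ℤ (Set.range latticeBasis) ↔ z ∈ Λ := by
  rw [coe_latticeBasis, Matrix.range_cons, Matrix.range_cons, Matrix.range_empty, Set.union_empty,
    Set.singleton_union, Submodule.mem_span_pair]
  constructor
  · rintro ⟨a, b, rfl⟩
    exact ⟨b, a, by simp [add_comm]⟩
  · rintro ⟨m, n, rfl⟩
    exact ⟨n, m, by simp [add_comm]⟩

lemma FΛ_eq : FΛ = ZSpan.fundamentalDomain latticeBasis := by
  have key : ∀ s t : ℝ, latticeBasis.repr (s + t * ω) 0 = s ∧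
      latticeBasis.repr (s + t * ω) 1 = t := by
    intro s t
    have h0 : (s + t * ω : ℂ) = s • latticeBasis 0 + t • latticeBasis 1 := by
      simp [coe_latticeBasis]
    rw [h0]
    simp only [map_add, map_smul, Module.Basis.repr_self]
    simp
  ext z
  rw [ZSpan.mem_fundamentalDomain, Fin.forall_fin_two]
  constructor
  · rintro ⟨s, t, hs, hs', ht, ht', rfl⟩
    rw [(key s t).1, (key s t).2]
    exact ⟨⟨hs, hs'⟩, ht, ht'⟩
  · rintro ⟨h0, h1⟩
    refine ⟨_, _, h0.1, h0.2, h1.1, h1.2, ?_⟩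
    have := latticeBasis.sum_repr z
    rw [Fin.sum_univ_two] at this
    conv_lhs => rw [← this]
    simp [coe_latticeBasis]

instance countable_span_latticeBasis :
    Countable (Submodule.span ℤ (Set.range latticeBasis)).toAddSubgroup :=
  Set.countable_coe_iff.mpr (countable_Λ.mono fun _ hz => mem_span_latticeBasis.mp hz)

lemma isAddFundamentalDomain_FΛ : IsAddFundamentalDomain
    (Submodule.span ℤ (Set.range latticeBasis)).toAddSubgroup FΛ (volume : Measure ℂ) := by
  rw [FΛ_eq]
  exact ZSpan.isAddFundamentalDomain' _ _

lemma measurableSet_FΛ : MeasurableSet FΛ := by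
  rw [FΛ_eq]
  exact ZSpan.fundamentalDomain_measurableSet _

lemma FΛ_subset : FΛ ⊆ Metric.closedBall 0 2 := by
  rintro z ⟨s, t, hs, hs', ht, ht', rfl⟩
  rw [mem_closedBall_zero_iff]
  refine (norm_add_le _ _).trans ?_
  rw [norm_mul, norm_ω, norm_real, norm_real, Real.norm_of_nonneg hs, Real.norm_of_nonneg ht]
  linarith

lemma setIntegral_FΛ_comp_mul {c : ℂ} (hc : ‖c‖ = 1) (hΛ : ∀ γ, c * γ ∈ Λ ↔ γ ∈ Λ)
    {φ : ℂ → ℂ} (hφ : ∀ γ ∈ Λ, ∀ z, φ (z + γ) = φ z) :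
    ∫ z in FΛ, φ (c * z) = ∫ z in FΛ, φ z := by
  have hc0 : c ≠ 0 := norm_ne_zero_iff.mp (by rw [hc]; exact one_ne_zero)
  set r : ℂ ≃ₗᵢ[ℝ] ℂ := rotation ⟨c, by simp [Submonoid.unitSphere, hc]⟩ with hr
  have hrz : ∀ z, r z = c * z := fun z => rotation_apply _ _
  have hmp : MeasurePreserving r volume volume := r.measurePreserving
  have himg : ∫ z in r '' FΛ, φ z = ∫ z in FΛ, φ (c * z) := by
    rw [hmp.setIntegral_image_emb r.toHomeomorph.measurableEmbedding]
    simp [hrz]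
  have hspan : Submodule.span ℤ (Set.range (latticeBasis.map r.toLinearEquiv)) =
      Submodule.span ℤ (Set.range latticeBasis) := by
    rw [← ZSpan.map latticeBasis r.toLinearEquiv]
    ext z
    rw [Submodule.mem_map, mem_span_latticeBasis]
    constructor
    · rintro ⟨y, hy, rfl⟩
      rw [mem_span_latticeBasis] at hy
      simpa [hrz] using (hΛ y).mpr hy
    · intro hz
      refine ⟨c⁻¹ * z, ?_, ?_⟩
      · rw [mem_span_latticeBasis, ← hΛ, mul_inv_cancel_left₀ hc0]
        exact hz
      · simp [hrz, mul_inv_cancel_left₀ hc0]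
  have hfd := ZSpan.isAddFundamentalDomain' (latticeBasis.map r.toLinearEquiv)
    (volume : Measure ℂ)
  rw [hspan, ← ZSpan.map_fundamentalDomain, ← FΛ_eq] at hfd
  rw [← himg]
  refine hfd.setIntegral_eq isAddFundamentalDomain_FΛ fun g z => ?_
  rw [AddSubgroup.vadd_def, vadd_eq_add, add_comm]
  exact hφ _ (mem_span_latticeBasis.mp g.2) z

/-! ### The multiplier `Fk` -/

lemma zmap_mul (c k : ℂ) : zmap (c * k) = c * zmap k := by
  rw [zmap, zmap]; ring

lemma zmap_neg (k : ℂ) : zmap (-k) = -zmap k := by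
  rw [zmap, zmap]; ring

lemma two_pi_I_mul_zmap (k : ℂ) : 2 * Real.pi * I * zmap k = Real.sqrt 3 * k / 2 := by
  have : (Real.pi : ℂ) ≠ 0 := by exact_mod_cast Real.pi_ne_zero
  rw [zmap]
  field_simp
  ring

lemma mem_Λdual_iff {k : ℂ} : k ∈ Λdual ↔ zmap k ∈ Λ := by
  have hpi : (Real.pi : ℂ) ≠ 0 := by exact_mod_cast Real.pi_ne_zero
  have h3 : (Real.sqrt 3 : ℂ) ≠ 0 := by simp
  have e : ∀ w : ℂ, k = 4 * Real.pi * I / Real.sqrt 3 * w ↔ zmap k = w := by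
    intro w
    rw [zmap, div_eq_iff (by simp [hpi]), div_mul_eq_mul_div, eq_div_iff h3]
    constructor <;> intro h <;> linear_combination h
  simp only [Λdual, Λ, Set.mem_ofPred_eq, e]

lemma ω_mul_mem_Λdual_iff {k : ℂ} : ω * k ∈ Λdual ↔ k ∈ Λdual := by
  rw [mem_Λdual_iff, mem_Λdual_iff, zmap_mul, ω_mul_mem_Λ_iff]

lemma neg_mem_Λdual_iff {k : ℂ} : -k ∈ Λdual ↔ k ∈ Λdual := by
  rw [mem_Λdual_iff, mem_Λdual_iff, zmap_neg, neg_mem_Λ_iff]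

@[fun_prop]
lemma continuous_zmap : Continuous zmap := by
  unfold zmap; fun_prop

lemma isOpen_compl_Λdual : IsOpen {k : ℂ | k ∉ Λdual} := by
  have : {k : ℂ | k ∉ Λdual} = (fun k => theta (zmap k)) ⁻¹' {0}ᶜ := by
    ext k
    simp [mem_Λdual_iff, theta_eq_zero_iff]
  rw [this]
  exact isOpen_compl_singleton.preimage (by fun_prop)

lemma Fk_add {γ : ℂ} (hγ : γ ∈ Λ) (k z : ℂ) : Fk k (z + γ) = Fk k z := by
  obtain ⟨m, l, rfl⟩ := hγ
  have e1 : z + (m * ω + l) - zmap k = (z - zmap k) + (m * ω + l) := by ring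
  have hconj : (starRingEnd ℂ) (z + (m * ω + l)) =
      (starRingEnd ℂ) z + (m * (-1 - ω) + l) := by
    simp [conj_ω, ω_sq]
  rw [Fk, Fk, e1, theta_add, theta_add, hconj, ← mul_assoc, ← Complex.exp_add]
  have e2 : I / 2 * (z + (m * ω + l) - ((starRingEnd ℂ) z + (m * (-1 - ω) + l))) * k +
      (-Real.pi * I * m ^ 2 * ω - 2 * Real.pi * I * m * (z - zmap k) - Real.pi * I * m +
        Real.pi * I * l) = (-Real.pi * I * m ^ 2 * ω - 2 * Real.pi * I * m * z -
        Real.pi * I * m + Real.pi * I * l) + I / 2 * (z - (starRingEnd ℂ) z) * k := by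
    rw [ω_eq]
    linear_combination (m : ℂ) * two_pi_I_mul_zmap k + (m * Real.sqrt 3 * k / 2) * I_sq
  rw [e2, Complex.exp_add, mul_assoc, mul_div_mul_left _ _ (exp_ne_zero _)]

lemma Fk_neg (k z : ℂ) : Fk (-k) (-z) = Fk k z := by
  have e1 : -z - zmap (-k) = -(z - zmap k) := by rw [zmap_neg]; ring
  rw [Fk, Fk, e1, theta_neg, theta_neg, mul_neg, neg_div_neg_eq]
  congr 3
  rw [map_neg]; ring

lemma Fk_ω_mul (k z : ℂ) :
    Fk (ω * k) (ω * z) = cexp (-Real.pi * I * ω * zmap k ^ 2) * Fk k z := by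
  obtain ⟨c, hc, h⟩ := theta_ω_mul
  have e1 : ω * z - zmap (ω * k) = ω * (z - zmap k) := by rw [zmap_mul]; ring
  rw [Fk, Fk, e1, h, h, map_mul, conj_ω]
  have e2 : I / 2 * (ω * z - ω ^ 2 * (starRingEnd ℂ) z) * (ω * k) +
      -Real.pi * I * ω * (z - zmap k) ^ 2 = -Real.pi * I * ω * z ^ 2 +
      (-Real.pi * I * ω * zmap k ^ 2 + I / 2 * (z - (starRingEnd ℂ) z) * k) := by
    have h3 : ω ^ 3 = 1 := by linear_combination (ω - 1) * ω_sq
    have h4 : I * (ω ^ 2 - 1) + Real.sqrt 3 * ω = 0 := by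
      rw [ω_sq, ω_eq]
      have hs : (Real.sqrt 3 : ℂ) ^ 2 = 3 := by
        rw [← ofReal_pow, Real.sq_sqrt (by norm_num)]; norm_num
      linear_combination (I / 2) * hs - (Real.sqrt 3 / 2 : ℂ) * I_sq
    linear_combination (z * ω) * two_pi_I_mul_zmap k + (z * k / 2) * h4 -
      (I / 2 * (starRingEnd ℂ) z * k) * h3
  have e3 : cexp (I / 2 * (ω * z - ω ^ 2 * (starRingEnd ℂ) z) * (ω * k)) *
      (c * cexp (-Real.pi * I * ω * (z - zmap k) ^ 2) * theta (z - zmap k)) =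
      (c * cexp (-Real.pi * I * ω * z ^ 2)) * (cexp (-Real.pi * I * ω * zmap k ^ 2) *
        (cexp (I / 2 * (z - (starRingEnd ℂ) z) * k) * theta (z - zmap k))) := by
    have := congrArg cexp e2
    rw [Complex.exp_add, Complex.exp_add, Complex.exp_add] at this
    linear_combination (c * theta (z - zmap k)) * this
  rw [e3, mul_div_mul_left _ _ (mul_ne_zero hc (exp_ne_zero _)), mul_div_assoc]

/-! ### Dividing the protected state by theta functions -/

/-- The function with simple zeros on `±z_S + Λ`. -/
def stackingTheta (z : ℂ) : ℂ := theta (z + zS) * theta (z - zS)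

/-- The two shifts `z_S` and `-z_S`. -/
def shift : Fin 2 → ℂ := ![zS, -zS]

/-- The numerator of `F_k(z + shift j)` over the common denominator `stackingTheta`. -/
def numer (j : Fin 2) (k z : ℂ) : ℂ :=
  cexp (I / 2 * ((z + shift j) - (starRingEnd ℂ) (z + shift j)) * k) *
    theta (z + shift j - zmap k) * theta (z - shift j)

lemma stackingTheta_eq (j : Fin 2) (z : ℂ) :
    stackingTheta z = theta (z + shift j) * theta (z - shift j) := by
  fin_cases j
  · simp [stackingTheta, shift]
  · simp [stackingTheta, shift, sub_eq_add_neg, mul_comm]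

lemma stackingTheta_eq_zero_iff {z : ℂ} :
    stackingTheta z = 0 ↔ z + zS ∈ Λ ∨ z - zS ∈ Λ := by
  rw [stackingTheta, mul_eq_zero, theta_eq_zero_iff, theta_eq_zero_iff]

lemma countable_stackingTheta_zeros : {z | stackingTheta z = 0}.Countable := by
  have : {z | stackingTheta z = 0} = (· + zS) ⁻¹' Λ ∪ (· - zS) ⁻¹' Λ := by
    ext z
    exact stackingTheta_eq_zero_iff
  rw [this]
  exact (countable_Λ.preimage (add_left_injective _)).union
    (countable_Λ.preimage (sub_left_injective))

lemma eq_of_eq_off_stackingTheta_zeros {X : Type*} [TopologicalSpace X] [T2Space X]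
    {f g : ℂ → X} (hf : Continuous f) (hg : Continuous g)
    (h : ∀ z, stackingTheta z ≠ 0 → f z = g z) : f = g :=
  hf.ext_on (countable_stackingTheta_zeros.dense_compl ℝ) hg fun z hz => h z hz

lemma differentiable_stackingTheta : Differentiable ℂ stackingTheta :=
  (differentiable_theta.comp (differentiable_id.add_const zS)).mul
    (differentiable_theta.comp (differentiable_id.sub_const zS))

lemma contDiff_theta {n : WithTop ℕ∞} : ContDiff ℝ n theta :=
  (differentiable_theta.contDiff (n := n)).restrict_scalars ℝ

lemma contDiff_conj {n : WithTop ℕ∞} : ContDiff ℝ n (starRingEnd ℂ : ℂ → ℂ) :=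
  conjCLE.contDiff

lemma contDiff_numer {n : WithTop ℕ∞} (j : Fin 2) (k : ℂ) : ContDiff ℝ n (numer j k) := by
  have h1 : ContDiff ℝ n (fun z : ℂ => z + shift j) := contDiff_id.add contDiff_const
  have h2 : ContDiff ℝ n
      (fun z : ℂ => I / 2 * ((z + shift j) - (starRingEnd ℂ) (z + shift j)) * k) :=
    (contDiff_const.mul (h1.sub (contDiff_conj.comp h1))).mul contDiff_const
  exact (h2.cexp.mul (contDiff_theta.comp (h1.sub contDiff_const))).mul
    (contDiff_theta.comp (contDiff_id.sub contDiff_const))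

lemma numer_eq_zero_iff {j : Fin 2} {k z : ℂ} :
    numer j k z = 0 ↔ z + shift j - zmap k ∈ Λ ∨ z - shift j ∈ Λ := by
  rw [numer, mul_eq_zero, mul_eq_zero, theta_eq_zero_iff, theta_eq_zero_iff]
  simp [exp_ne_zero]

lemma Fk_mul_stackingTheta {j : Fin 2} {k z : ℂ} (hz : stackingTheta z ≠ 0) :
    Fk k (z + shift j) * stackingTheta z = numer j k z := by
  rw [stackingTheta_eq j] at hz ⊢
  have := left_ne_zero_of_mul hz
  rw [Fk, numer]
  field_simp

lemma half_not_mem_Λ : (1 / 2 : ℂ) ∉ Λ := by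
  rintro ⟨m, n, h⟩
  have h1 := congrArg im h
  have h2 := congrArg re h
  simp [ω_im_pos.ne'] at h1
  simp [h1] at h2
  field_simp at h2
  have h3 : (1 : ℤ) = 2 * n := Int.cast_injective (α := ℝ) (by push_cast; linarith)
  omega

lemma exists_zmap_eq (w : ℂ) : ∃ k, zmap k = w := by
  have hpi : (Real.pi : ℂ) ≠ 0 := by exact_mod_cast Real.pi_ne_zero
  have h3 : (Real.sqrt 3 : ℂ) ≠ 0 := by simp
  refine ⟨4 * Real.pi * I / Real.sqrt 3 * w, ?_⟩
  rw [zmap]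
  field_simp

lemma sub_mem_Λ {a b : ℂ} (ha : a ∈ Λ) (hb : b ∈ Λ) : a - b ∈ Λ := by
  rw [sub_eq_add_neg]
  exact add_mem_Λ ha (neg_mem_Λ hb)

lemma numer_zero_ne_or_one_ne {k : ℂ} (hk : zmap k = 1 / 2) (z : ℂ) :
    numer 0 k z ≠ 0 ∨ numer 1 k z ≠ 0 := by
  by_contra! h
  rw [numer_eq_zero_iff, numer_eq_zero_iff, hk] at h
  simp only [shift, Matrix.cons_val_zero, Matrix.cons_val_one] at h
  obtain ⟨h0 | h0, h1 | h1⟩ := h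
  · apply two_mul_zS_not_mem
    convert sub_mem_Λ h0 h1 using 1; ring
  · apply half_not_mem_Λ
    convert sub_mem_Λ h1 h0 using 1; ring
  · apply half_not_mem_Λ
    convert sub_mem_Λ h0 h1 using 1; ring
  · apply two_mul_zS_not_mem
    convert sub_mem_Λ h1 h0 using 1; ring

lemma exists_smooth_quotient {u₀ : ℂ → ℂ × ℂ} (hu₀ : ContDiff ℝ (⊤ : ℕ∞) u₀)
    {uu : Fin 2 → ℂ → ℂ → ℂ × ℂ}
    (hs : ∀ (j : Fin 2), ∀ k ∉ Λdual, ContDiff ℝ (⊤ : ℕ∞) (uu j k))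
    (huu : ∀ (j : Fin 2), ∀ k ∉ Λdual, ∀ z : ℂ, z + shift j ∉ Λ →
      uu j k z = Fk k (z + shift j) • u₀ z) :
    ∃ W : ℂ → ℂ × ℂ, ContDiff ℝ (⊤ : ℕ∞) W ∧ (∀ z, u₀ z = stackingTheta z • W z) ∧
      ∀ (j : Fin 2), ∀ k ∉ Λdual, ∀ z, uu j k z = numer j k z • W z := by
  have hoff : ∀ (j : Fin 2), ∀ k ∉ Λdual, ∀ z : ℂ, stackingTheta z ≠ 0 →
      stackingTheta z • uu j k z = numer j k z • u₀ z := by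
    intro j k hk z hz
    have hz' := hz
    rw [stackingTheta_eq j] at hz'
    rw [huu j k hk z fun hmem => left_ne_zero_of_mul hz' (theta_eq_zero_iff.mpr hmem), smul_smul,
      mul_comm, Fk_mul_stackingTheta hz]
  obtain ⟨k₀, hk₀⟩ := exists_zmap_eq (1 / 2)
  have hk₀' : k₀ ∉ Λdual := by
    rw [mem_Λdual_iff, hk₀]
    exact half_not_mem_Λ
  set W : ℂ → ℂ × ℂ := fun z => if numer 0 k₀ z ≠ 0 then (numer 0 k₀ z)⁻¹ • uu 0 k₀ z else
    (numer 1 k₀ z)⁻¹ • uu 1 k₀ z with hW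
  have hcompat : ∀ z, numer 1 k₀ z • uu 0 k₀ z = numer 0 k₀ z • uu 1 k₀ z := by
    refine congrFun (eq_of_eq_off_stackingTheta_zeros
      ((contDiff_numer (n := 0) 1 k₀).continuous.smul (hs 0 k₀ hk₀').continuous)
      ((contDiff_numer (n := 0) 0 k₀).continuous.smul (hs 1 k₀ hk₀').continuous) fun z hz => ?_)
    apply smul_right_injective _ hz
    simp only
    rw [smul_comm, hoff 0 k₀ hk₀' z hz, smul_comm (stackingTheta z), hoff 1 k₀ hk₀' z hz,
      smul_comm]
  have hWj : ∀ (j : Fin 2) (z : ℂ), numer j k₀ z ≠ 0 → W z = (numer j k₀ z)⁻¹ • uu j k₀ z := by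
    intro j z hz
    by_cases h0 : numer 0 k₀ z ≠ 0
    · simp only [hW, if_pos h0]
      fin_cases j
      · rfl
      · simp only [Fin.mk_one, Fin.isValue] at hz ⊢
        rw [inv_smul_eq_iff₀ h0, smul_comm, ← hcompat, inv_smul_smul₀ hz]
    · simp only [hW, if_neg h0]
      fin_cases j
      · exact absurd hz h0
      · rfl
  have hex : ∀ z, ∃ j : Fin 2, numer j k₀ z ≠ 0 := fun z =>
    (numer_zero_ne_or_one_ne hk₀ z).elim (fun h => ⟨0, h⟩) fun h => ⟨1, h⟩
  have hWs : ContDiff ℝ (⊤ : ℕ∞) W := by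
    rw [contDiff_iff_contDiffAt]
    intro z
    obtain ⟨j, hj⟩ := hex z
    have hc := contDiff_numer (n := (⊤ : ℕ∞)) j k₀
    refine ContDiffAt.congr_of_eventuallyEq
      ((hc.contDiffAt.inv hj).smul (hs j k₀ hk₀').contDiffAt) ?_
    filter_upwards [hc.continuous.continuousAt.eventually_ne hj] with w hw using hWj j w hw
  have hWoff : ∀ z, stackingTheta z ≠ 0 → u₀ z = stackingTheta z • W z := by
    intro z hz
    obtain ⟨j, hj⟩ := hex z
    rw [hWj j z hj, smul_comm, hoff j k₀ hk₀' z hz, inv_smul_smul₀ hj]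
  have hWu : ∀ z, u₀ z = stackingTheta z • W z :=
    congrFun (eq_of_eq_off_stackingTheta_zeros hu₀.continuous
      (differentiable_stackingTheta.continuous.smul hWs.continuous) hWoff)
  refine ⟨W, hWs, hWu, fun j k hk => congrFun (eq_of_eq_off_stackingTheta_zeros
    (hs j k hk).continuous
    ((contDiff_numer (n := 0) j k).continuous.smul hWs.continuous) fun z hz => ?_)⟩
  apply smul_right_injective _ hz
  simp only
  rw [hoff j k hk z hz, hWu z, smul_comm]

/-- The product of two translates of `theta` with opposite shifts. -/
def thetaPair (a z : ℂ) : ℂ := theta (z + a) * theta (z - a)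

lemma thetaPair_zS : thetaPair zS = stackingTheta := rfl

lemma differentiable_thetaPair (a : ℂ) : Differentiable ℂ (thetaPair a) :=
  (differentiable_theta.comp (differentiable_id.add_const a)).mul
    (differentiable_theta.comp (differentiable_id.sub_const a))

lemma contDiff_thetaPair {n : WithTop ℕ∞} (a : ℂ) : ContDiff ℝ n (thetaPair a) :=
  ((differentiable_thetaPair a).contDiff (n := n)).restrict_scalars ℝ

lemma thetaPair_add {γ : ℂ} (hγ : γ ∈ Λ) : ∃ m : ℂ → ℂ, (∀ z, m z ≠ 0) ∧
    ∀ a z : ℂ, thetaPair a (z + γ) = m z * thetaPair a z := by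
  obtain ⟨A, B, h⟩ := theta_add_of_mem hγ
  refine ⟨fun z => cexp (2 * A * z + 2 * B), fun z => exp_ne_zero _, fun a z => ?_⟩
  simp only
  have e1 : z + γ + a = z + a + γ := by ring
  have e2 : z + γ - a = z - a + γ := by ring
  have e3 : 2 * A * z + 2 * B = (A * (z + a) + B) + (A * (z - a) + B) := by ring
  rw [e3, thetaPair, thetaPair, e1, e2, h, h, exp_add (A * (z + a) + B)]
  ring

lemma Dbar_holomorphic_mul {P f : ℂ → ℂ} {z : ℂ} (hP : DifferentiableAt ℂ P z)
    (hf : DifferentiableAt ℝ f z) : Dbar (fun w => P w * f w) z = P z * Dbar f z := by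
  have hPR : DifferentiableAt ℝ P z := hP.restrictScalars ℝ
  have hI : fderiv ℝ P z I = I * fderiv ℝ P z 1 := by
    rw [hP.fderiv_restrictScalars ℝ]
    simp only [ContinuousLinearMap.coe_restrictScalars']
    simp
  rw [Dbar, Dbar, fderiv_fun_mul hPR hf]
  simp only [add_apply, smul_apply, smul_eq_mul, hI]
  linear_combination (1 / I * f z * fderiv ℝ P z 1) * I_sq

lemma Dbar_comp_neg (f : ℂ → ℂ) (z : ℂ) : Dbar (fun w => f (-w)) z = -Dbar f (-z) := by
  have h := (ContinuousLinearEquiv.neg ℝ : ℂ ≃L[ℝ] ℂ).comp_right_fderiv (f := f) (x := z)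
  change fderiv ℝ (fun w => f (-w)) z = _ at h
  rw [Dbar, Dbar, h]
  simp
  ring

lemma Dbar_neg (f : ℂ → ℂ) (z : ℂ) : Dbar (fun w => -f w) z = -Dbar f z := by
  rw [Dbar, Dbar, fderiv_fun_neg]
  simp only [neg_apply]
  ring

lemma continuous_Dbar {f : ℂ → ℂ} (hf : ContDiff ℝ (⊤ : ℕ∞) f) : Continuous (Dbar f) := by
  have h := hf.continuous_fderiv (by simp)
  unfold Dbar
  fun_prop

lemma inKer_thetaPair_smul {Up Um : ℂ → ℂ} (hUp : Continuous Up) (hUm : Continuous Um) {α : ℂ}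
    {W : ℂ → ℂ × ℂ} (hW : ContDiff ℝ (⊤ : ℕ∞) W)
    (h : InKer Up Um α 0 fun z => stackingTheta z • W z) (a : ℂ) :
    InKer Up Um α 0 fun z => thetaPair a z • W z := by
  obtain ⟨-, h1, h2, h3, h4⟩ := h
  have hW1 : ContDiff ℝ (⊤ : ℕ∞) fun z => (W z).1 := contDiff_fst.comp hW
  have hW2 : ContDiff ℝ (⊤ : ℕ∞) fun z => (W z).2 := contDiff_snd.comp hW
  have pde : ∀ {f g V : ℂ → ℂ}, ContDiff ℝ (⊤ : ℕ∞) f → Continuous g → Continuous V →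
      (∀ z, Dbar (fun w => stackingTheta w * f w) z + 0 * (stackingTheta z * f z) +
        α * V z * (stackingTheta z * g z) = 0) →
      ∀ z, Dbar (fun w => thetaPair a w * f w) z + 0 * (thetaPair a z * f z) +
        α * V z * (thetaPair a z * g z) = 0 := by
    intro f g V hf hg hV hpde z
    have hd : ∀ z, DifferentiableAt ℝ f z := fun z => hf.differentiable (by simp) z
    have key : (fun z => Dbar f z + α * V z * g z) = fun _ => 0 := by
      refine eq_of_eq_off_stackingTheta_zeros
        ((continuous_Dbar hf).add ((continuous_const.mul hV).mul hg)) continuous_const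
        fun z hz => ?_
      have := hpde z
      rw [Dbar_holomorphic_mul (differentiable_stackingTheta z) (hd z)] at this
      refine (mul_eq_zero.mp ?_).resolve_left hz
      linear_combination this
    rw [Dbar_holomorphic_mul (differentiable_thetaPair a z) (hd z)]
    linear_combination thetaPair a z * congrFun key z
  have per : ∀ {f : ℂ → ℂ} {γ c : ℂ}, Continuous f → γ ∈ Λ →
      (∀ z, stackingTheta (z + γ) * f (z + γ) = c * (stackingTheta z * f z)) →
      ∀ z, thetaPair a (z + γ) * f (z + γ) = c * (thetaPair a z * f z) := by
    intro f γ c hf hγ hper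
    obtain ⟨m, hm0, hm⟩ := thetaPair_add hγ
    refine congrFun (eq_of_eq_off_stackingTheta_zeros
      (((differentiable_thetaPair a).continuous.comp (continuous_add_const γ)).mul
        (hf.comp (continuous_add_const γ)))
      (continuous_const.mul ((differentiable_thetaPair a).continuous.mul hf)) fun z hz => ?_)
    have := hper z
    rw [← thetaPair_zS, hm zS z] at this
    rw [← thetaPair_zS] at hz
    rw [hm a z]
    refine mul_left_cancel₀ hz ?_
    linear_combination thetaPair a z * this
  refine ⟨(contDiff_thetaPair a).smul hW, pde hW1 hW2.continuous hUp h1,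
    pde hW2 hW1.continuous hUm h2, fun γ hγ => per hW1.continuous hγ (h3 γ hγ),
    fun γ hγ => per hW2.continuous hγ (h4 γ hγ)⟩

/-- The symmetry `u ↦ (u₂(-z), -u₁(-z))` of the chiral model. -/
def flip (u : ℂ → ℂ × ℂ) (z : ℂ) : ℂ × ℂ := ((u (-z)).2, -(u (-z)).1)

lemma inKer_flip {U : ℂ → ℂ} {α : ℂ} {u : ℂ → ℂ × ℂ} (h : InKer U (fun z => U (-z)) α 0 u) :
    InKer U (fun z => U (-z)) α 0 (flip u) := by
  obtain ⟨h0, h1, h2, h3, h4⟩ := h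
  have hp : ∀ γ, pair (-γ) K = -pair γ K := fun γ => by simp [pair]
  refine ⟨?_, fun z => ?_, fun z => ?_, fun γ hγ z => ?_, fun γ hγ z => ?_⟩
  · have := h0.comp contDiff_neg
    exact (contDiff_snd.comp this).prodMk (contDiff_fst.comp this).neg
  · simp only [flip]
    have := h2 (-z)
    simp only [neg_neg] at this
    rw [Dbar_comp_neg (fun w => (u w).2) z]
    linear_combination -this
  · simp only [flip]
    have := h1 (-z)
    rw [Dbar_neg (fun w => (u (-w)).1) z, Dbar_comp_neg (fun w => (u w).1) z]
    linear_combination this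
  · simp only [flip]
    rw [neg_add, h4 _ (neg_mem_Λ hγ), hp]
    push_cast; ring_nf
  · simp only [flip]
    rw [neg_add, h3 _ (neg_mem_Λ hγ), hp]
    push_cast; ring_nf

lemma half_add_zS_not_mem_Λ : (1 / 2 + zS : ℂ) ∉ Λ := fun h => two_mul_zS_not_mem (by
  convert sub_mem_Λ (add_mem_Λ h h) (⟨0, 1, by simp⟩ : (1 : ℂ) ∈ Λ) using 1
  ring)

lemma half_sub_zS_not_mem_Λ : (1 / 2 - zS : ℂ) ∉ Λ := fun h => two_mul_zS_not_mem (by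
  convert sub_mem_Λ (⟨0, 1, by simp⟩ : (1 : ℂ) ∈ Λ) (add_mem_Λ h h) using 1
  ring)

lemma half_ω_add_half_not_mem_Λ : (ω * (1 / 2) + 1 / 2 : ℂ) ∉ Λ := fun h => half_not_mem_Λ (by
  rw [← ω_mul_mem_Λ_iff, ← ω_mul_mem_Λ_iff, ← neg_mem_Λ_iff]
  convert h using 1
  linear_combination (-1 / 2 : ℂ) * ω_sq)

lemma half_ω_sub_half_not_mem_Λ : (ω * (1 / 2) - 1 / 2 : ℂ) ∉ Λ := fun h =>
  half_ω_add_half_not_mem_Λ (by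
    convert add_mem_Λ h (⟨0, 1, by simp⟩ : (1 : ℂ) ∈ Λ) using 1
    ring)

lemma thetaPair_half_rotation_ne :
    thetaPair (1 / 2) (ω * (1 / 2)) * stackingTheta (1 / 2) ≠
      thetaPair (1 / 2) (1 / 2) * stackingTheta (ω * (1 / 2)) := by
  have h0 : thetaPair (1 / 2) (1 / 2) = 0 := by
    rw [thetaPair, sub_self, theta_zero, mul_zero]
  rw [h0, zero_mul, ← thetaPair_zS, thetaPair, thetaPair]
  simp only [ne_eq, mul_eq_zero, theta_eq_zero_iff, not_or]
  exact ⟨⟨half_ω_add_half_not_mem_Λ, half_ω_sub_half_not_mem_Λ⟩,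
    half_add_zS_not_mem_Λ, half_sub_zS_not_mem_Λ⟩

lemma flip_smul_of_kerDim_eq_two {U : ℂ → ℂ} (hU : Continuous U) {α : ℂ}
    (hα : kerDim U (fun z => U (-z)) α 0 = 2) {u₀ W : ℂ → ℂ × ℂ}
    (hu₀ : InKer U (fun z => U (-z)) α 0 u₀) (hrot : ∀ z, u₀ (ω * z) = u₀ z) (hne : u₀ ≠ 0)
    (hW : ContDiff ℝ (⊤ : ℕ∞) W) (hu₀W : ∀ z, u₀ z = stackingTheta z • W z) :
    ∃ c : ℂ, ∀ z, flip u₀ z = c • u₀ z := by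
  set w : ℂ → ℂ × ℂ := fun z => thetaPair (1 / 2) z • W z with hw
  have hUn : Continuous fun z => U (-z) := hU.comp continuous_neg
  have hwker : InKer U (fun z => U (-z)) α 0 w := by
    refine inKer_thetaPair_smul hU hUn hW ?_ _
    convert hu₀ using 1
    exact funext fun z => (hu₀W z).symm
  have hdep : ∃ c : Fin 3 → ℂ, c 0 • u₀ + c 1 • w + c 2 • flip u₀ = 0 ∧ c ≠ 0 := by
    set S := Submodule.span ℂ (kerSet U (fun z => U (-z)) α 0) with hS
    have hfin : Module.finrank ℂ S = 2 := hα
    have : FiniteDimensional ℂ S := Module.finite_of_finrank_pos (by omega)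
    set v : Fin 3 → S := ![⟨u₀, Submodule.subset_span hu₀⟩, ⟨w, Submodule.subset_span hwker⟩,
      ⟨flip u₀, Submodule.subset_span (inKer_flip hu₀)⟩] with hv
    have hli : ¬ LinearIndependent ℂ v := fun hli => by
      have := hli.fintype_card_le_finrank
      rw [hfin] at this
      simp at this
    obtain ⟨c, hc, i, hi⟩ := Fintype.not_linearIndependent_iff.mp hli
    refine ⟨c, ?_, fun h => hi (congrFun h i)⟩
    have := congrArg (Subtype.val) hc
    simpa [Fin.sum_univ_three, hv] using this
  obtain ⟨c, hc, hc0⟩ := hdep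
  have hcz : ∀ z, c 0 • u₀ z + c 1 • w z + c 2 • flip u₀ z = 0 := fun z => congrFun hc z
  have hfrot : ∀ z, flip u₀ (ω * z) = flip u₀ z := fun z => by
    rw [flip, flip, ← mul_neg, hrot]
  have hc1 : c 1 = 0 := by
    by_contra h1
    have hwrot : ∀ z, w (ω * z) = w z := fun z => by
      have e := hcz (ω * z)
      rw [hrot, hfrot] at e
      have e' := (e.trans (hcz z).symm)
      rw [add_left_inj, add_right_inj] at e'
      exact smul_right_injective _ h1 e'
    obtain ⟨z₀, hz₀⟩ : ∃ z₀, W z₀ ≠ 0 := by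
      by_contra! hW0
      exact hne (funext fun z => by rw [hu₀W, hW0, smul_zero]; rfl)
    have hev : ∀ᶠ z in nhds z₀, thetaPair (1 / 2) (ω * z) * stackingTheta z =
        thetaPair (1 / 2) z * stackingTheta (ω * z) := by
      filter_upwards [hW.continuous.continuousAt.eventually_ne hz₀] with z hz
      refine smul_left_injective ℂ hz ?_
      have e1 := hwrot z
      have e2 := hrot z
      simp only [hw] at e1
      rw [hu₀W, hu₀W] at e2
      simp only
      rw [mul_smul, ← e2, smul_comm, e1, smul_smul, mul_comm]
    have hd : Differentiable ℂ (fun z : ℂ => ω * z) := by fun_prop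
    have han : ∀ {f : ℂ → ℂ}, Differentiable ℂ f → AnalyticOnNhd ℂ f Set.univ := fun hf =>
      hf.differentiableOn.analyticOnNhd isOpen_univ
    have heq := (han (((differentiable_thetaPair (1 / 2)).comp hd).mul
      differentiable_stackingTheta)).eq_of_eventuallyEq (han ((differentiable_thetaPair
        (1 / 2)).mul (differentiable_stackingTheta.comp hd))) hev
    exact thetaPair_half_rotation_ne (congrFun heq (1 / 2))
  have hc2 : c 2 ≠ 0 := by
    intro h2
    have h0 : c 0 = 0 := by
      by_contra h0
      refine hne (funext fun z => ?_)
      have := hcz z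
      rw [hc1, h2, zero_smul, zero_smul, add_zero, add_zero] at this
      exact (smul_eq_zero.mp this).resolve_left h0
    refine hc0 (funext fun i => ?_)
    fin_cases i
    exacts [h0, hc1, h2]
  refine ⟨-(c 0 / c 2), fun z => smul_right_injective _ hc2 ?_⟩
  have := hcz z
  rw [hc1, zero_smul, add_zero] at this
  simp only [smul_smul]
  rw [mul_neg, mul_div_cancel₀ _ hc2, neg_smul]
  exact eq_neg_of_add_eq_zero_right this

/-- The pointwise squared Hermitian norm of `u`. -/
def density (u : ℂ → ℂ × ℂ) (z : ℂ) : ℝ := normSq (u z).1 + normSq (u z).2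

lemma density_neg {u : ℂ → ℂ × ℂ} (hne : u ≠ 0) {c : ℂ} (h : ∀ z, flip u z = c • u z) (z : ℂ) :
    density u (-z) = density u z := by
  have h1 : ∀ z, (u (-z)).2 = c * (u z).1 := fun z => congrArg Prod.fst (h z)
  have h2 : ∀ z, -(u (-z)).1 = c * (u z).2 := fun z => congrArg Prod.snd (h z)
  have hc : c ^ 2 = -1 := by
    by_contra hc
    refine hne (funext fun z => Prod.ext ?_ ?_)
    all_goals
      refine (mul_eq_zero.mp ?_).resolve_left (sub_ne_zero.mpr hc)
      have e1 := h1 (-z)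
      have e2 := h2 (-z)
      have e3 := h1 z
      have e4 := h2 z
      rw [neg_neg] at e1 e2
    · linear_combination -e2 - c * e3
    · linear_combination e1 - c * e4
  have hn : normSq c = 1 := by
    have := congrArg normSq hc
    rw [map_pow, normSq_neg, normSq_one] at this
    exact (pow_eq_one_iff_of_nonneg (normSq_nonneg c) (by norm_num)).mp this
  rw [density, density, h1, ← normSq_neg (u (-z)).1, h2, normSq_mul, normSq_mul, hn]
  ring

lemma density_add {Up Um : ℂ → ℂ} {α : ℂ} {u : ℂ → ℂ × ℂ} (h : InKer Up Um α 0 u) {γ : ℂ}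
    (hγ : γ ∈ Λ) (z : ℂ) : density u (z + γ) = density u z := by
  have hn : ∀ t : ℝ, normSq (cexp (I * t)) = 1 := fun t => by
    rw [normSq_eq_norm_sq, mul_comm, norm_exp_ofReal_mul_I, one_pow]
  have hn' : ∀ t : ℝ, normSq (cexp (-I * t)) = 1 := fun t => by
    simpa using hn (-t)
  rw [density, density, h.2.2.2.1 γ hγ, h.2.2.2.2 γ hγ, normSq_mul, normSq_mul, hn, hn', one_mul,
    one_mul]

/-- The Gramian of the functions `F_k(· + shift j)` with respect to the weight `N`. -/
def weightedGram (N : ℂ → ℝ) (k : ℂ) : Matrix (Fin 2) (Fin 2) ℂ := fun j l =>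
  ∫ z in FΛ, Fk k (z + shift j) * (starRingEnd ℂ) (Fk k (z + shift l)) * N z

lemma shift_one_sub (j : Fin 2) : shift (1 - j) = -shift j := by
  fin_cases j <;> simp [shift]

lemma shift_sub_ω_mul_mem (j : Fin 2) : shift j - ω * shift j ∈ Λ := by
  have h0 : zS - ω * zS ∈ Λ := ⟨1, 1, by rw [ω_mul_zS]; push_cast; ring⟩
  fin_cases j
  · exact h0
  · have := neg_mem_Λ h0
    simp only [shift, Fin.mk_one, Matrix.cons_val_one, Matrix.cons_val_fin_one]
    convert this using 1
    ring

lemma weightedGram_integrand_add {N : ℂ → ℝ} (hN : ∀ γ ∈ Λ, ∀ z, N (z + γ) = N z) (k : ℂ)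
    (j l : Fin 2) {γ : ℂ} (hγ : γ ∈ Λ) (z : ℂ) :
    Fk k (z + γ + shift j) * (starRingEnd ℂ) (Fk k (z + γ + shift l)) * N (z + γ) =
      Fk k (z + shift j) * (starRingEnd ℂ) (Fk k (z + shift l)) * N z := by
  rw [add_right_comm, Fk_add hγ, add_right_comm, Fk_add hγ, hN γ hγ]

lemma weightedGram_neg {N : ℂ → ℝ} (hN : ∀ γ ∈ Λ, ∀ z, N (z + γ) = N z)
    (hneg : ∀ z, N (-z) = N z) (k : ℂ) (j l : Fin 2) :
    weightedGram N (-k) j l = weightedGram N k (1 - j) (1 - l) := by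
  have hF : ∀ (i : Fin 2) (z : ℂ), Fk (-k) (-1 * z + shift i) = Fk k (z + shift (1 - i)) := by
    intro i z
    rw [shift_one_sub, ← Fk_neg k (z + -shift i)]
    congr 1
    ring
  rw [weightedGram, weightedGram, ← setIntegral_FΛ_comp_mul (c := -1) (by simp)
    (fun γ => by rw [neg_one_mul, neg_mem_Λ_iff])
    fun γ hγ z => weightedGram_integrand_add hN (-k) j l hγ z]
  simp only [hF]
  simp only [neg_one_mul, hneg]

lemma weightedGram_ω_mul {N : ℂ → ℝ} (hN : ∀ γ ∈ Λ, ∀ z, N (z + γ) = N z)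
    (hω : ∀ z, N (ω * z) = N z) (k : ℂ) (j l : Fin 2) :
    weightedGram N (ω * k) j l =
      (normSq (cexp (-Real.pi * I * ω * zmap k ^ 2)) : ℂ) * weightedGram N k j l := by
  have hF : ∀ (i : Fin 2) (z : ℂ), Fk (ω * k) (ω * z + shift i) =
      cexp (-Real.pi * I * ω * zmap k ^ 2) * Fk k (z + shift i) := by
    intro i z
    rw [← Fk_ω_mul, ← Fk_add (shift_sub_ω_mul_mem i) (ω * k) (ω * (z + shift i))]
    congr 1
    ring
  rw [weightedGram, weightedGram, ← setIntegral_FΛ_comp_mul (c := ω) norm_ω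
    (fun γ => ω_mul_mem_Λ_iff)
    fun γ hγ z => weightedGram_integrand_add hN (ω * k) j l hγ z, ← integral_const_mul]
  simp only [hF, hω, map_mul, normSq_eq_conj_mul_self]
  congr 1
  ext z
  ring

lemma det_weightedGram_neg {N : ℂ → ℝ} (hN : ∀ γ ∈ Λ, ∀ z, N (z + γ) = N z)
    (hneg : ∀ z, N (-z) = N z) (k : ℂ) :
    (weightedGram N (-k)).det = (weightedGram N k).det := by
  rw [Matrix.det_fin_two, Matrix.det_fin_two]
  simp only [weightedGram_neg hN hneg, sub_zero, sub_self]
  ring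

lemma det_weightedGram_ω_mul {N : ℂ → ℝ} (hN : ∀ γ ∈ Λ, ∀ z, N (z + γ) = N z)
    (hω : ∀ z, N (ω * z) = N z) (k : ℂ) :
    (weightedGram N (ω * k)).det =
      ((normSq (cexp (-Real.pi * I * ω * zmap k ^ 2)) ^ 2 : ℝ) : ℂ) *
        (weightedGram N k).det := by
  rw [Matrix.det_fin_two, Matrix.det_fin_two]
  simp only [weightedGram_ω_mul hN hω]
  push_cast
  ring

lemma gram_eq_weightedGram {u₀ : ℂ → ℂ × ℂ} {k : ℂ} {v : Fin 2 → ℂ → ℂ × ℂ}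
    (hv : ∀ (j : Fin 2) (z : ℂ), z + shift j ∉ Λ → v j z = Fk k (z + shift j) • u₀ z)
    (j l : Fin 2) :
    ∫ z in FΛ, ((v j z).1 * (starRingEnd ℂ) (v l z).1 + (v j z).2 * (starRingEnd ℂ) (v l z).2) =
      weightedGram (density u₀) k j l := by
  refine integral_congr_ae (ae_restrict_of_ae ?_)
  filter_upwards [measure_eq_zero_iff_ae_notMem.mp
    (countable_stackingTheta_zeros.measure_zero (volume : Measure ℂ))] with z hz
  have hmem : ∀ i, z + shift i ∉ Λ := fun i h => hz (by
    rw [stackingTheta_eq i, theta_eq_zero_iff.mpr h, zero_mul])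
  rw [hv j z (hmem j), hv l z (hmem l)]
  simp only [Prod.smul_fst, Prod.smul_snd, smul_eq_mul, map_mul, density, ofReal_add,
    normSq_eq_conj_mul_self]
  ring

section

open scoped InnerProductSpace

lemma differentiable_continuousMap_of_eval {X : Type*} [TopologicalSpace X] [CompactSpace X]
    {Φ : ℂ → C(X, ℂ)} (hΦ : Continuous Φ) (hd : ∀ x, Differentiable ℂ fun k => Φ k x) :
    Differentiable ℂ Φ := by
  intro c
  have hint : ∀ w ∈ Metric.ball c 1, ContinuousOn (fun z => (z - w)⁻¹ • Φ z)
      (Metric.sphere c 1) := by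
    intro w hw
    refine ContinuousOn.smul (ContinuousOn.inv₀ (f := fun z => z - w) (by fun_prop)
      fun z hz => ?_) hΦ.continuousOn
    rw [sub_ne_zero]
    rintro rfl
    exact absurd hw (by simp [Metric.mem_sphere.mp hz])
  have key : ∀ w ∈ Metric.ball c 1,
      Φ w = (2 * Real.pi * I : ℂ)⁻¹ • ∮ z in C(c, 1), (z - w)⁻¹ • Φ z := by
    intro w hw
    ext x
    have h1 := ((hd x).diffContOnCl
      (s := Metric.ball c 1)).two_pi_i_inv_smul_circleIntegral_sub_inv_smul hw
    have h2 : ContinuousMap.evalCLM ℂ x (∮ z in C(c, 1), (z - w)⁻¹ • Φ z) =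
        ∮ z in C(c, 1), (z - w)⁻¹ • Φ z x := by
      have h3 := ((hint w hw).circleIntegrable zero_le_one).out
      rw [circleIntegral, ← ContinuousLinearMap.intervalIntegral_comp_comm _ h3, circleIntegral]
      rfl
    rw [ContinuousMap.smul_apply, ← h1, ← h2]
    rfl
  have hps := hasFPowerSeriesOn_cauchy_integral (f := Φ) (c := c) (R := 1)
    (hΦ.continuousOn.circleIntegrable zero_le_one) one_pos
  refine (hps.analyticAt.differentiableAt).congr_of_eventuallyEq ?_
  filter_upwards [Metric.ball_mem_nhds c one_pos] with w hw using key w hw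

/-- Lebesgue measure on the fundamental domain, carried by a compact disc. -/
def discMeasure : Measure (Metric.closedBall (0 : ℂ) 2) :=
  (volume.restrict FΛ).comap Subtype.val

lemma map_discMeasure : discMeasure.map Subtype.val = volume.restrict FΛ := by
  rw [discMeasure, map_comap_subtype_coe Metric.isClosed_closedBall.measurableSet,
    Measure.restrict_restrict Metric.isClosed_closedBall.measurableSet,
    Set.inter_eq_right.mpr FΛ_subset]

instance : IsFiniteMeasure discMeasure := by
  refine ⟨?_⟩
  have h := congrArg (fun μ => μ Set.univ) map_discMeasure
  simp only [Measure.map_apply measurable_subtype_coe MeasurableSet.univ, Set.preimage_univ,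
    Measure.restrict_apply_univ] at h
  rw [h]
  exact (measure_mono FΛ_subset).trans_lt measure_closedBall_lt_top

/-- The square-integrable function on the fundamental domain given by `f k`. -/
def l2Section (f : C(ℂ × ℂ, ℂ)) (k : ℂ) : Lp ℂ 2 discMeasure :=
  ContinuousMap.toLp 2 discMeasure ℂ ((f.curry k).restrict _)

lemma differentiable_l2Section {f : C(ℂ × ℂ, ℂ)}
    (hd : ∀ z, Differentiable ℂ fun k => f (k, z)) : Differentiable ℂ (l2Section f) := by
  have h : Differentiable ℂ
      fun k => (f.curry k).restrict (Metric.closedBall (0 : ℂ) 2) :=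
    differentiable_continuousMap_of_eval
      ((ContinuousMap.continuous_precomp (ContinuousMap.restrict _ (.id ℂ))).comp
        f.curry.continuous) fun x => hd x
  exact (ContinuousMap.toLp (E := ℂ) 2 discMeasure ℂ).differentiable.comp h

lemma inner_l2Section (f g : C(ℂ × ℂ, ℂ)) (k : ℂ) :
    ⟪l2Section f k, l2Section g k⟫_ℂ =
      ∫ z in FΛ, g (k, z) * (starRingEnd ℂ) (f (k, z)) := by
  rw [l2Section, l2Section, ContinuousMap.inner_toLp, ← map_discMeasure,
    (MeasurableEmbedding.subtype_coe Metric.isClosed_closedBall.measurableSet).integral_map]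
  rfl

lemma ae_eq_zero_of_l2Section_combination {f : Fin 2 → C(ℂ × ℂ, ℂ)} {c : Fin 2 → ℂ} {k : ℂ}
    (h : ∑ j, c j • l2Section (f j) k = 0) :
    ∀ᵐ z ∂volume.restrict FΛ, ∑ j, c j * f j (k, z) = 0 := by
  rw [← map_discMeasure,
    (MeasurableEmbedding.subtype_coe Metric.isClosed_closedBall.measurableSet).ae_map_iff]
  have h1 : ContinuousMap.toLp 2 discMeasure ℂ
      (∑ j, c j • ((f j).curry k).restrict (Metric.closedBall (0 : ℂ) 2)) = 0 := by
    rw [map_sum, ← h]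
    simp only [map_smul, l2Section]
  have h2 := ContinuousMap.coeFn_toLp (p := 2) (𝕜 := ℂ) discMeasure
    (∑ j, c j • ((f j).curry k).restrict (Metric.closedBall (0 : ℂ) 2))
  rw [h1] at h2
  filter_upwards [h2, Lp.coeFn_zero ℂ 2 discMeasure] with x hx hx0
  rw [hx0] at hx
  simpa [Fin.sum_univ_two] using hx.symm

end

section

open scoped InnerProductSpace

lemma continuous_numer (j : Fin 2) : Continuous fun p : ℂ × ℂ => numer j p.1 p.2 := by
  unfold numer
  have := continuous_theta
  have := Complex.continuous_conj
  fun_prop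

lemma differentiable_numer (j : Fin 2) (z : ℂ) : Differentiable ℂ fun k => numer j k z := by
  have h1 : Differentiable ℂ fun k => theta (z + shift j - zmap k) := by
    refine differentiable_theta.comp ((differentiable_const _).sub ?_)
    unfold zmap
    fun_prop
  unfold numer
  fun_prop

/-- The function `numer j` weighted by `N`, as a continuous function of both variables. -/
def weightedNumer (N : C(ℂ, ℝ)) (j : Fin 2) : C(ℂ × ℂ, ℂ) where
  toFun p := numer j p.1 p.2 * N p.2
  continuous_toFun := (continuous_numer j).mul (by fun_prop)

lemma differentiable_weightedNumer (N : C(ℂ, ℝ)) (j : Fin 2) (z : ℂ) :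
    Differentiable ℂ fun k => weightedNumer N j (k, z) :=
  (differentiable_numer j z).mul_const (N z : ℂ)

lemma eq_zero_of_combination_numer_eq_zero {k z₀ : ℂ} (hk : k ∉ Λdual) {c : Fin 2 → ℂ}
    (h : ∀ᶠ z in nhds z₀, ∑ j, c j * numer j k z = 0) : c = 0 := by
  set e : Fin 2 → ℂ := fun j => cexp (I / 2 * (shift j - (starRingEnd ℂ) (shift j)) * k) with he
  set B : ℂ → ℂ := fun z =>
    ∑ j, c j * (e j * theta (z + shift j - zmap k) * theta (z - shift j)) with hB
  have hfac : ∀ z, ∑ j, c j * numer j k z =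
      cexp (I / 2 * (z - (starRingEnd ℂ) z) * k) * B z := by
    intro z
    rw [hB, Finset.mul_sum]
    refine Finset.sum_congr rfl fun j _ => ?_
    have : I / 2 * (z + shift j - (starRingEnd ℂ) (z + shift j)) * k =
        I / 2 * (z - (starRingEnd ℂ) z) * k +
          I / 2 * (shift j - (starRingEnd ℂ) (shift j)) * k := by
      rw [map_add]; ring
    rw [numer, this, exp_add]
    ring
  have hBd : Differentiable ℂ B := by
    refine Differentiable.fun_sum fun j _ => Differentiable.const_mul (Differentiable.mul
      (Differentiable.const_mul ?_ _) ?_) _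
    · exact differentiable_theta.comp ((differentiable_id.add_const _).sub_const _)
    · exact differentiable_theta.comp (differentiable_id.sub_const _)
  have hB0 : B = 0 := by
    refine (hBd.differentiableOn.analyticOnNhd isOpen_univ).eq_of_eventuallyEq
      (analyticOnNhd_const (v := (0 : ℂ))) (z₀ := z₀) ?_
    filter_upwards [h] with z hz
    rw [hfac] at hz
    exact (mul_eq_zero.mp hz).resolve_left (exp_ne_zero _)
  have hθ : theta (-zmap k) ≠ 0 := by
    rw [Ne, theta_eq_zero_iff, neg_mem_Λ_iff, ← mem_Λdual_iff]
    exact hk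
  have h2 : ∀ j, theta (-2 * shift j) ≠ 0 := fun j => by
    rw [Ne, theta_eq_zero_iff]
    fin_cases j
    · rw [← neg_mem_Λ_iff]
      simpa [shift] using two_mul_zS_not_mem
    · simpa [shift] using two_mul_zS_not_mem
  have hval : ∀ j, c j * (e j * theta (-zmap k) * theta (-2 * shift j)) = 0 := by
    intro j
    have := congrFun hB0 (-shift j)
    simp only [hB, Fin.sum_univ_two, Pi.zero_apply] at this
    have e1 : -shift j + shift j - zmap k = -zmap k := by ring
    have e2 : -shift j - shift j = -2 * shift j := by ring
    have e3 : theta (-shift j - shift (1 - j)) = 0 := by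
      rw [shift_one_sub, sub_self, theta_zero]
    fin_cases j
    · simp only [Fin.zero_eta, sub_zero] at e1 e2 e3 this ⊢
      rw [e1, e2, e3] at this
      simpa using this
    · simp only [Fin.mk_one, sub_self] at e1 e2 e3 this ⊢
      rw [e1, e2, e3] at this
      simpa using this
  funext j
  refine (mul_eq_zero.mp (hval j)).resolve_right ?_
  exact mul_ne_zero (mul_ne_zero (exp_ne_zero _) hθ) (h2 j)

lemma linearIndependent_l2Section {N : C(ℂ, ℝ)} (hN0 : ∃ z, N z ≠ 0)
    (hN : ∀ γ ∈ Λ, ∀ z, ‖stackingTheta (z + γ)‖ * N (z + γ) = ‖stackingTheta z‖ * N z) {k : ℂ}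
    (hk : k ∉ Λdual) :
    LinearIndependent ℂ fun j => l2Section (weightedNumer N j) k := by
  rw [Fintype.linearIndependent_iff]
  intro c hc
  have hFk : ∀ z, stackingTheta z ≠ 0 →
      ((∑ j, c j * Fk k (z + shift j)) * (‖stackingTheta z‖ * N z : ℝ) = 0 ↔
        ∑ j, c j * weightedNumer N j (k, z) = 0) := by
    intro z hz
    have e : ∑ j, c j * weightedNumer N j (k, z) =
        (∑ j, c j * Fk k (z + shift j)) * stackingTheta z * N z := by
      rw [Finset.sum_mul, Finset.sum_mul]
      refine Finset.sum_congr rfl fun j _ => ?_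
      change c j * (numer j k z * N z) = _
      rw [← Fk_mul_stackingTheta hz]
      ring
    rw [e]
    push_cast
    simp [hz]
  have hoff : ∀ᵐ z : ℂ, stackingTheta z ≠ 0 :=
    measure_eq_zero_iff_ae_notMem.mp (countable_stackingTheta_zeros.measure_zero volume)
  set t : Set ℂ := {z | (∑ j, c j * Fk k (z + shift j)) * (‖stackingTheta z‖ * N z : ℝ) ≠ 0}
    with ht
  have ht0 : volume t = 0 := by
    refine isAddFundamentalDomain_FΛ.measure_zero_of_invariant t (fun γ => ?_) ?_
    · have hinv : ∀ γ ∈ Λ, ∀ z, z + γ ∈ t ↔ z ∈ t := fun γ hγ z => by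
        simp only [ht, Set.mem_ofPred_eq, hN γ hγ z, add_right_comm z γ, Fk_add hγ]
      ext z
      rw [Set.mem_vadd_set_iff_neg_vadd_mem, AddSubgroup.vadd_def, vadd_eq_add, add_comm]
      exact hinv _ (mem_span_latticeBasis.mp (-γ).2) z
    · rw [← Measure.restrict_apply₀', measure_eq_zero_iff_ae_notMem]
      · filter_upwards [ae_eq_zero_of_l2Section_combination hc, ae_restrict_of_ae hoff]
          with z hz hQ
        simpa only [ht, Set.mem_ofPred_eq, not_not] using (hFk z hQ).mpr hz
      · exact measurableSet_FΛ.nullMeasurableSet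
  have hzero : (fun z => ∑ j, c j * weightedNumer N j (k, z)) = fun _ => 0 := by
    refine Measure.eq_of_ae_eq (μ := (volume : Measure ℂ)) ?_ (by fun_prop) continuous_const
    filter_upwards [measure_eq_zero_iff_ae_notMem.mp ht0, hoff] with z hz hQ
    exact (hFk z hQ).mp (not_not.mp hz)
  obtain ⟨z₀, hz₀⟩ := hN0
  refine congrFun (eq_zero_of_combination_numer_eq_zero hk (z₀ := z₀) ?_)
  filter_upwards [N.continuous.continuousAt.eventually_ne hz₀] with z hz
  have h := congrFun hzero z
  have hz' : (N z : ℂ) ≠ 0 := ofReal_ne_zero.mpr hz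
  refine (mul_eq_zero.mp ?_).resolve_right hz'
  rw [← h, Finset.sum_mul]
  refine Finset.sum_congr rfl fun j _ => ?_
  change _ = c j * (numer j k z * N z)
  ring

lemma continuous_density {u : ℂ → ℂ × ℂ} (hu : Continuous u) : Continuous (density u) :=
  (continuous_normSq.comp (continuous_fst.comp hu)).add
    (continuous_normSq.comp (continuous_snd.comp hu))

lemma density_nonneg (u : ℂ → ℂ × ℂ) (z : ℂ) : 0 ≤ density u z :=
  add_nonneg (normSq_nonneg _) (normSq_nonneg _)

/-- The pointwise Hermitian norm of a continuous `W`. -/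
def pointwiseNorm (W : C(ℂ, ℂ × ℂ)) : C(ℂ, ℝ) where
  toFun z := Real.sqrt (density W z)
  continuous_toFun := (continuous_density W.continuous).sqrt

lemma pointwiseNorm_ne_zero {W : C(ℂ, ℂ × ℂ)} {z : ℂ} (h : W z ≠ 0) : pointwiseNorm W z ≠ 0 := by
  refine fun h0 => h ?_
  have h1 : density W z = 0 := (Real.sqrt_eq_zero (density_nonneg W z)).mp h0
  rw [density, add_eq_zero_iff_of_nonneg (normSq_nonneg _) (normSq_nonneg _), normSq_eq_zero,
    normSq_eq_zero] at h1
  exact Prod.ext h1.1 h1.2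

lemma norm_mul_pointwiseNorm {u₀ : ℂ → ℂ × ℂ} {W : C(ℂ, ℂ × ℂ)} {Q : ℂ → ℂ}
    (h : ∀ z, u₀ z = Q z • W z) (z : ℂ) :
    ‖Q z‖ * pointwiseNorm W z = Real.sqrt (density u₀ z) := by
  have : density u₀ z = ‖Q z‖ ^ 2 * density W z := by
    simp only [density, h, Prod.smul_fst, Prod.smul_snd, smul_eq_mul,
      normSq_eq_norm_sq, norm_mul]
    ring
  rw [this, Real.sqrt_mul (by positivity), Real.sqrt_sq (norm_nonneg _)]
  rfl

lemma gram_eq_inner {W : C(ℂ, ℂ × ℂ)} {k : ℂ} {v : Fin 2 → ℂ → ℂ × ℂ}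
    (hv : ∀ (j : Fin 2) (z : ℂ), v j z = numer j k z • W z) (j l : Fin 2) :
    ∫ z in FΛ, ((v j z).1 * (starRingEnd ℂ) (v l z).1 + (v j z).2 * (starRingEnd ℂ) (v l z).2) =
      ⟪l2Section (weightedNumer (pointwiseNorm W) l) k,
        l2Section (weightedNumer (pointwiseNorm W) j) k⟫_ℂ := by
  rw [inner_l2Section]
  congr 1
  ext z
  have h1 : ((pointwiseNorm W z : ℝ) : ℂ) * (pointwiseNorm W z : ℝ) = (density W z : ℝ) := by
    rw [← ofReal_mul]
    exact congrArg _ (Real.mul_self_sqrt (density_nonneg W z))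
  change _ = numer j k z * (pointwiseNorm W z : ℝ) *
    (starRingEnd ℂ) (numer l k z * (pointwiseNorm W z : ℝ))
  rw [hv, hv, map_mul, conj_ofReal, mul_mul_mul_comm, h1, density]
  simp only [Prod.smul_fst, Prod.smul_snd, smul_eq_mul, map_mul, ofReal_add,
    normSq_eq_conj_mul_self]
  ring

end

section

open scoped InnerProductSpace TensorProduct

/-- The real-linear map `h ↦ p h + q conj h`. -/
def wirtinger (p q : ℂ) : ℂ →L[ℝ] ℂ :=
  p • (ContinuousLinearMap.id ℝ ℂ) + q • (conjCLE : ℂ →L[ℝ] ℂ)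

lemma wirtinger_apply (p q h : ℂ) : wirtinger p q h = p * h + q * (starRingEnd ℂ) h := rfl

lemma hasFDerivAt_wirtinger_of_forall {f : ℂ → ℂ} {L : ℂ →L[ℝ] ℂ} {p q k : ℂ}
    (hf : HasFDerivAt f L k) (h : ∀ v, L v = p * v + q * (starRingEnd ℂ) v) :
    HasFDerivAt f (wirtinger p q) k :=
  hf.congr_fderiv (ContinuousLinearMap.ext h)

lemma dk_eq_of_hasFDerivAt {f : ℂ → ℂ} {p q k : ℂ} (h : HasFDerivAt f (wirtinger p q) k) :
    dk f k = p := by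
  rw [dk, h.fderiv, wirtinger_apply, wirtinger_apply, map_one, conj_I]
  linear_combination (-p / 2 + q / 2) * I_sq

lemma dkbar_eq_of_hasFDerivAt {f : ℂ → ℂ} {p q k : ℂ} (h : HasFDerivAt f (wirtinger p q) k) :
    dkbar f k = q := by
  rw [dkbar, h.fderiv, wirtinger_apply, wirtinger_apply, map_one, conj_I]
  linear_combination (p / 2 - q / 2) * I_sq

lemma hasFDerivAt_wirtinger {f : ℂ → ℂ} {k : ℂ} (h : DifferentiableAt ℝ f k) :
    HasFDerivAt f (wirtinger (dk f k) (dkbar f k)) k := by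
  refine hasFDerivAt_wirtinger_of_forall h.hasFDerivAt fun v => ?_
  have hv : fderiv ℝ f k v = v.re * fderiv ℝ f k 1 + v.im * fderiv ℝ f k I := by
    conv_lhs => rw [show v = v.re • (1 : ℂ) + v.im • I by simp]
    rw [map_add, map_smul, map_smul, real_smul, real_smul]
  have h2 : (starRingEnd ℂ) v = v.re - v.im * I := by
    apply Complex.ext <;> simp
  rw [hv, dk, dkbar, h2]
  linear_combination (fderiv ℝ f k I * v.im) * I_sq +
    ((fderiv ℝ f k 1 - I * fderiv ℝ f k I) / 2) * re_add_im v

lemma hasFDerivAt_comp_wirtinger {f F : ℂ → ℂ} {F' p q k : ℂ} (hF : HasDerivAt F F' (f k))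
    (hf : HasFDerivAt f (wirtinger p q) k) :
    HasFDerivAt (fun w => F (f w)) (wirtinger (F' * p) (F' * q)) k := by
  refine hasFDerivAt_wirtinger_of_forall ((hF.hasFDerivAt.restrictScalars ℝ).comp k hf)
    fun v => ?_
  simp [wirtinger_apply]
  ring

lemma hasFDerivAt_wirtinger_comp_mul {f : ℂ → ℂ} {p q c k : ℂ}
    (hf : HasFDerivAt f (wirtinger p q) (c * k)) :
    HasFDerivAt (fun w => f (c * w)) (wirtinger (c * p) ((starRingEnd ℂ) c * q)) k := by
  have h1 : HasFDerivAt (fun w : ℂ => c * w) (c • ContinuousLinearMap.id ℝ ℂ) k :=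
    (hasFDerivAt_id k).const_mul c
  refine hasFDerivAt_wirtinger_of_forall (hf.comp k h1) fun v => ?_
  simp [wirtinger_apply]
  ring

lemma hasFDerivAt_wirtinger_div {u v : ℂ → ℂ} {p q p' q' k : ℂ}
    (hu : HasFDerivAt u (wirtinger p q) k) (hv : HasFDerivAt v (wirtinger p' q') k)
    (h0 : v k ≠ 0) :
    HasFDerivAt (fun w => u w / v w) (wirtinger ((p * v k - u k * p') / v k ^ 2)
      ((q * v k - u k * q') / v k ^ 2)) k := by
  have hinv := hasFDerivAt_comp_wirtinger (hasDerivAt_inv h0) hv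
  refine hasFDerivAt_wirtinger_of_forall (hu.mul hinv) fun w => ?_
  simp [wirtinger_apply]
  field_simp
  ring

lemma hasFDerivAt_wirtinger_add {u v : ℂ → ℂ} {p q p' q' k : ℂ}
    (hu : HasFDerivAt u (wirtinger p q) k) (hv : HasFDerivAt v (wirtinger p' q') k) :
    HasFDerivAt (fun w => u w + v w) (wirtinger (p + p') (q + q')) k := by
  refine hasFDerivAt_wirtinger_of_forall (hu.add hv) fun w => ?_
  simp [wirtinger_apply]
  ring

lemma hasFDerivAt_wirtinger_two_re {a : ℂ → ℂ} {a' k : ℂ} (ha : HasDerivAt a a' k) :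
    HasFDerivAt (fun w => ((2 * (a w).re : ℝ) : ℂ)) (wirtinger a' ((starRingEnd ℂ) a')) k := by
  have h1 := ha.hasFDerivAt.restrictScalars ℝ
  have h2 := (conjCLE : ℂ →L[ℝ] ℂ).hasFDerivAt.comp k h1
  have h3 : (fun w => ((2 * (a w).re : ℝ) : ℂ)) = fun w => a w + (starRingEnd ℂ) (a w) :=
    funext fun w => (add_conj (a w)).symm
  rw [h3]
  refine hasFDerivAt_wirtinger_of_forall (h1.add h2) fun v => ?_
  simp
  ring

section

variable {E : Type*} [NormedAddCommGroup E] [InnerProductSpace ℂ E]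

lemma hasFDerivAt_inner_wirtinger {u v : ℂ → E} {u' v' : E} {k : ℂ} (hu : HasDerivAt u u' k)
    (hv : HasDerivAt v v' k) :
    HasFDerivAt (fun w => ⟪u w, v w⟫_ℂ) (wirtinger ⟪u k, v'⟫_ℂ ⟪u', v k⟫_ℂ) k := by
  refine hasFDerivAt_wirtinger_of_forall
    ((hu.hasFDerivAt.restrictScalars ℝ).inner ℂ (hv.hasFDerivAt.restrictScalars ℝ)) fun w => ?_
  simp [inner_smul_left, inner_smul_right]
  ring

lemma hasFDerivAt_log_inner_self {s : ℂ → E} {s' : E} {k : ℂ} (hs : HasDerivAt s s' k)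
    (h0 : s k ≠ 0) :
    HasFDerivAt (fun w => ((Real.log (‖s w‖ ^ 2 / 2) : ℝ) : ℂ))
      (wirtinger (⟪s k, s'⟫_ℂ / ⟪s k, s k⟫_ℂ) (⟪s', s k⟫_ℂ / ⟪s k, s k⟫_ℂ)) k := by
  have hpos : 0 < ‖s k‖ ^ 2 / 2 := by positivity
  have hval : ∀ w, ⟪s w, s w⟫_ℂ / 2 = ((‖s w‖ ^ 2 / 2 : ℝ) : ℂ) := fun w => by
    rw [inner_self_eq_norm_sq_to_K]
    push_cast
    rfl
  have hslit : ⟪s k, s k⟫_ℂ / 2 ∈ slitPlane := by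
    rw [hval, ofReal_mem_slitPlane]
    exact hpos
  have hne : ⟪s k, s k⟫_ℂ ≠ 0 := inner_self_ne_zero.mpr h0
  have hdiv := hasFDerivAt_comp_wirtinger (F := fun x => x / 2)
    ((hasDerivAt_id' (⟪s k, s k⟫_ℂ)).div_const 2) (hasFDerivAt_inner_wirtinger hs hs)
  have hlog := hasFDerivAt_comp_wirtinger (f := fun w => ⟪s w, s w⟫_ℂ / 2)
    (hasDerivAt_log hslit) hdiv
  have heq : (fun w => ((Real.log (‖s w‖ ^ 2 / 2) : ℝ) : ℂ)) =
      fun w => Complex.log (⟪s w, s w⟫_ℂ / 2) :=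
    funext fun w => by rw [ofReal_log (by positivity), ← hval]
  rw [heq]
  convert hlog using 2 <;> field_simp

lemma hasFDerivAt_dk_log_norm_sq {s s' : ℂ → E} {s'' : E} {k : ℂ}
    (hs : ∀ w, HasDerivAt s (s' w) w) (hs' : HasDerivAt s' s'' k) (h0 : s k ≠ 0) :
    ∃ p, HasFDerivAt (dk fun w => ((Real.log (‖s w‖ ^ 2 / 2) : ℝ) : ℂ))
      (wirtinger p ((‖s k‖ ^ 2 * ‖s' k‖ ^ 2 - ‖⟪s k, s' k⟫_ℂ‖ ^ 2) / ‖s k‖ ^ 4 : ℝ)) k := by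
  have hne : ⟪s k, s k⟫_ℂ ≠ 0 := inner_self_ne_zero.mpr h0
  have hq := hasFDerivAt_wirtinger_div (hasFDerivAt_inner_wirtinger (hs k) hs')
    (hasFDerivAt_inner_wirtinger (hs k) (hs k)) hne
  refine ⟨(⟪s k, s''⟫_ℂ * ⟪s k, s k⟫_ℂ - ⟪s k, s' k⟫_ℂ * ⟪s k, s' k⟫_ℂ) / ⟪s k, s k⟫_ℂ ^ 2,
    HasFDerivAt.congr_of_eventuallyEq ?_ (f := fun w => ⟪s w, s' w⟫_ℂ / ⟪s w, s w⟫_ℂ) ?_⟩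
  · convert hq using 2
    have e : ⟪s k, s' k⟫_ℂ * ⟪s' k, s k⟫_ℂ = ((‖⟪s k, s' k⟫_ℂ‖ ^ 2 : ℝ) : ℂ) := by
      rw [← inner_conj_symm (s' k) (s k), mul_conj, normSq_eq_norm_sq]
    rw [e, inner_self_eq_norm_sq_to_K, inner_self_eq_norm_sq_to_K]
    push_cast
    congr 1
    · simp only [coe_algebraMap]
      ring
    · simp only [coe_algebraMap]
      ring
  · filter_upwards [(hs k).continuousAt.eventually_ne h0] with w hw
    exact dk_eq_of_hasFDerivAt (hasFDerivAt_log_inner_self (hs w) hw)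

/-- The antisymmetrised tensor `x ∧ y`, as an element of `E ⊗ E`. -/
def wedge (x y : E) : E ⊗[ℂ] E := x ⊗ₜ y - y ⊗ₜ x

lemma norm_sq_wedge (x y : E) : ((‖wedge x y‖ ^ 2 / 2 : ℝ) : ℂ) =
    ⟪x, x⟫_ℂ * ⟪y, y⟫_ℂ - ⟪x, y⟫_ℂ * ⟪y, x⟫_ℂ := by
  have h : ((‖wedge x y‖ ^ 2 : ℝ) : ℂ) = ⟪wedge x y, wedge x y⟫_ℂ := by
    rw [inner_self_eq_norm_sq_to_K (𝕜 := ℂ) (wedge x y)]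
    push_cast
    rfl
  push_cast at h ⊢
  rw [h, wedge, inner_sub_left, inner_sub_right, inner_sub_right]
  simp only [TensorProduct.inner_tmul]
  ring

lemma hasDerivAt_wedge {a b : ℂ → E} {a' b' : E} {k : ℂ} (ha : HasDerivAt a a' k)
    (hb : HasDerivAt b b' k) :
    HasDerivAt (fun w => wedge (a w) (b w)) (wedge a' (b k) + wedge (a k) b') k := by
  have h1 := (TensorProduct.mkL ℂ E E).hasDerivAt_of_bilinear (fun _ => ha) (fun _ => hb)
  have h2 := (TensorProduct.mkL ℂ E E).hasDerivAt_of_bilinear (fun _ => hb) (fun _ => ha)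
  refine (h1.sub h2).congr_deriv ?_
  simp only [wedge, TensorProduct.mkL_apply_apply]
  abel

end

end

section

open scoped InnerProductSpace Topology ComplexOrder

lemma dk_eventuallyEq {f f' : ℂ → ℂ} {k : ℂ} (h : f =ᶠ[𝓝 k] f') : dk f =ᶠ[𝓝 k] dk f' := by
  filter_upwards [h.fderiv (𝕜 := ℝ)] with w hw
  simp only [dk, hw]

lemma dkbar_eq_of_eventuallyEq {f f' : ℂ → ℂ} {k : ℂ} (h : f =ᶠ[𝓝 k] f') :
    dkbar f k = dkbar f' k := by
  simp only [dkbar, h.fderiv_eq (𝕜 := ℝ)]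

/-- The Laplacian `∂_k̄ ∂_k L` is unchanged under a rotation preserving `L` up to the real part of
a holomorphic function. -/
lemma dkbar_dk_mul_eq {L a : ℂ → ℂ} {c k : ℂ} (hc : (starRingEnd ℂ) c * c = 1)
    (ha : Differentiable ℂ a)
    (hL : ∀ᶠ w in 𝓝 k, L (c * w) = L w + ((2 * (a w).re : ℝ) : ℂ))
    (h1 : ∀ᶠ w in 𝓝 k, DifferentiableAt ℝ L w) (h2 : DifferentiableAt ℝ (dk L) k)
    (h1c : ∀ᶠ w in 𝓝 k, DifferentiableAt ℝ L (c * w))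
    (h2c : DifferentiableAt ℝ (dk L) (c * k)) :
    dkbar (dk L) (c * k) = dkbar (dk L) k := by
  have hrot : dk (fun w => L (c * w)) =ᶠ[𝓝 k] fun w => c * dk L (c * w) := by
    filter_upwards [h1c] with w hw
    exact dk_eq_of_hasFDerivAt (hasFDerivAt_wirtinger_comp_mul (hasFDerivAt_wirtinger hw))
  have hadd : dk (fun w => L (c * w)) =ᶠ[𝓝 k] fun w => dk L w + deriv a w := by
    refine (dk_eventuallyEq hL).trans ?_
    filter_upwards [h1] with w hw
    exact dk_eq_of_hasFDerivAt (hasFDerivAt_wirtinger_add (hasFDerivAt_wirtinger hw)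
      (hasFDerivAt_wirtinger_two_re (ha w).hasDerivAt))
  have hrot' := dkbar_eq_of_hasFDerivAt (hasFDerivAt_comp_wirtinger (F := fun x => c * x)
    ((hasDerivAt_id' _).const_mul c) (hasFDerivAt_wirtinger_comp_mul (hasFDerivAt_wirtinger h2c)))
  have hda : HasFDerivAt (deriv a) (wirtinger (deriv (deriv a) k) 0) k :=
    hasFDerivAt_wirtinger_of_forall
      ((ha.deriv k).hasDerivAt.hasFDerivAt.restrictScalars ℝ) fun v => by
        simp [mul_comm]
  have hadd' := dkbar_eq_of_hasFDerivAt
    (hasFDerivAt_wirtinger_add (hasFDerivAt_wirtinger h2) hda)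
  have key := dkbar_eq_of_eventuallyEq (hrot.symm.trans hadd)
  rw [hrot', hadd'] at key
  linear_combination key - dkbar (dk L) (c * k) * hc

section

variable {E : Type*} [NormedAddCommGroup E] [InnerProductSpace ℂ E]

lemma dkbar_dk_log_norm_sq {L : ℂ → ℂ} {s s' : ℂ → E} {k : ℂ}
    (hs : ∀ w, HasDerivAt s (s' w) w) (hs' : DifferentiableAt ℂ s' k) (h0 : s k ≠ 0)
    (hL : ∀ᶠ w in 𝓝 k, L w = ((Real.log (‖s w‖ ^ 2 / 2) : ℝ) : ℂ)) :
    DifferentiableAt ℝ L k ∧ DifferentiableAt ℝ (dk L) k ∧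
      (dkbar (dk L) k).im = 0 ∧ 0 ≤ (dkbar (dk L) k).re := by
  obtain ⟨p, hp⟩ := hasFDerivAt_dk_log_norm_sq hs hs'.hasDerivAt h0
  have hp' := hp.congr_of_eventuallyEq (dk_eventuallyEq hL)
  refine ⟨((hasFDerivAt_log_inner_self (hs k) h0).congr_of_eventuallyEq hL).differentiableAt,
    hp'.differentiableAt, ?_, ?_⟩
  · rw [dkbar_eq_of_hasFDerivAt hp', ofReal_im]
  · rw [dkbar_eq_of_hasFDerivAt hp', ofReal_re]
    refine div_nonneg (sub_nonneg.mpr ?_) (by positivity)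
    rw [← mul_pow]
    exact pow_le_pow_left₀ (norm_nonneg _) (norm_inner_le_norm _ _) 2

lemma norm_sq_wedge_pos {v : Fin 2 → E} (hv : LinearIndependent ℂ v) :
    0 < ‖wedge (v 0) (v 1)‖ ^ 2 := by
  have h := (Matrix.posDef_gram_of_linearIndependent (𝕜 := ℂ) hv).det_pos
  rw [Matrix.det_fin_two] at h
  simp only [Matrix.gram_apply] at h
  rw [← norm_sq_wedge, zero_lt_real] at h
  linarith

lemma det_gram_transpose {M : Matrix (Fin 2) (Fin 2) ℂ} {v : Fin 2 → E}
    (hM : ∀ j l, M j l = ⟪v l, v j⟫_ℂ) : M.det = ((‖wedge (v 0) (v 1)‖ ^ 2 / 2 : ℝ) : ℂ) := by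
  rw [norm_sq_wedge, Matrix.det_fin_two]
  simp only [hM]
  ring

/-- The curvature of a holomorphic frame: where the frame is independent, the determinant of its
Gramian is positive and `∂_k̄ ∂_k` of its logarithm is nonnegative. -/
lemma dkbar_dk_log_det_gram [CompleteSpace E] {S : Set ℂ} (hS : IsOpen S) {a : Fin 2 → ℂ → E}
    (ha : ∀ j, Differentiable ℂ (a j)) (hli : ∀ k ∈ S, LinearIndependent ℂ fun j => a j k)
    {M : ℂ → Matrix (Fin 2) (Fin 2) ℂ} (hM : ∀ k ∈ S, ∀ j l, M k j l = ⟪a l k, a j k⟫_ℂ)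
    {L : ℂ → ℂ} (hL : ∀ k, L k = ((Real.log (M k).det.re : ℝ) : ℂ)) {k : ℂ} (hk : k ∈ S) :
    (0 < (M k).det.re ∧ (M k).det.im = 0) ∧ DifferentiableAt ℝ L k ∧
      DifferentiableAt ℝ (dk L) k ∧ (dkbar (dk L) k).im = 0 ∧ 0 ≤ (dkbar (dk L) k).re := by
  have hpos : 0 < ‖wedge (a 0 k) (a 1 k)‖ ^ 2 :=
    norm_sq_wedge_pos (v := fun j => a j k) (hli k hk)
  have hdet : ∀ w ∈ S, (M w).det = ((‖wedge (a 0 w) (a 1 w)‖ ^ 2 / 2 : ℝ) : ℂ) := fun w hw =>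
    det_gram_transpose (v := fun j => a j w) (hM w hw)
  refine ⟨?_, dkbar_dk_log_norm_sq (s := fun w => wedge (a 0 w) (a 1 w))
    (s' := fun w => wedge (deriv (a 0) w) (a 1 w) + wedge (a 0 w) (deriv (a 1) w))
    (fun w => hasDerivAt_wedge (ha 0 w).hasDerivAt (ha 1 w).hasDerivAt) ?_ ?_ ?_⟩
  · rw [hdet k hk, ofReal_re, ofReal_im]
    exact ⟨by positivity, rfl⟩
  · exact (hasDerivAt_wedge ((ha 0).deriv k).hasDerivAt (ha 1 k).hasDerivAt).differentiableAt.add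
      (hasDerivAt_wedge (ha 0 k).hasDerivAt ((ha 1).deriv k).hasDerivAt).differentiableAt
  · intro h
    simp [h] at hpos
  · filter_upwards [hS.mem_nhds hk] with w hw
    rw [hL, hdet w hw, ofReal_re]

end

end

/-- **Statement 16: nonnegativity and symmetry of the Berry curvature for a four-fold
degenerate flat band.** In the two-fold degenerate Gramian setting, `g(k) > 0` off `Λ*`
and `H = ∂_k̄ ∂_k log g` is real, nonnegative, and invariant under `k ↦ ωk`, `k ↦ −k`. -/
theorem berry_curvature_nonneg_symm
    (U : ℂ → ℂ) (hU : IsTunnelling U)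
    (hsym : ∀ z : ℂ, (starRingEnd ℂ) (U ((starRingEnd ℂ) z)) = -U (-z))
    (α : ℂ) (hα : ∀ k : ℂ, kerDim U (fun z => U (-z)) α k = 2)
    (u₀ : ℂ → ℂ × ℂ) (hu₀ : u₀ ∈ kerPSet U (fun z => U (-z)) α 0) (hu₀ne : u₀ ≠ 0)
    (uu : Fin 2 → ℂ → ℂ → ℂ × ℂ)
    (huus : ∀ (j : Fin 2), ∀ k ∉ Λdual, ContDiff ℝ (⊤ : ℕ∞) (uu j k))
    (huu0 : ∀ k ∉ Λdual, ∀ z : ℂ, z + zS ∉ Λ → uu 0 k z = Fk k (z + zS) • u₀ z)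
    (huu1 : ∀ k ∉ Λdual, ∀ z : ℂ, z - zS ∉ Λ → uu 1 k z = Fk k (z - zS) • u₀ z)
    (G : ℂ → Matrix (Fin 2) (Fin 2) ℂ)
    (hG : ∀ (k : ℂ) (j l : Fin 2), G k j l = ∫ z in FΛ,
      ((uu j k z).1 * (starRingEnd ℂ) ((uu l k z).1) +
        (uu j k z).2 * (starRingEnd ℂ) ((uu l k z).2)))
    (g : ℂ → ℂ) (hg : ∀ k : ℂ, g k = (G k).det)
    (H : ℂ → ℂ)
    (hH : ∀ k : ℂ, H k = dkbar (fun p => dk (fun q => ((Real.log (g q).re : ℝ) : ℂ)) p) k) :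
    ∀ k : ℂ, k ∉ Λdual →
      0 < (g k).re ∧ (g k).im = 0 ∧
      (H k).im = 0 ∧ 0 ≤ (H k).re ∧ H (ω * k) = H k ∧ H (-k) = H k := by
  have hrot : ∀ z, u₀ (ω * z) = u₀ z := by simpa using hu₀.2
  have hker : InKer U (fun z => U (-z)) α 0 u₀ := hu₀.1
  have huu : ∀ (j : Fin 2), ∀ k ∉ Λdual, ∀ z : ℂ, z + shift j ∉ Λ →
      uu j k z = Fk k (z + shift j) • u₀ z := by
    refine Fin.forall_fin_two.mpr ⟨huu0, fun k hk z hz => ?_⟩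
    simp only [shift, Matrix.cons_val_one, Matrix.cons_val_fin_one, ← sub_eq_add_neg] at hz ⊢
    exact huu1 k hk z hz
  obtain ⟨W, hW, hu₀W, huuW⟩ := exists_smooth_quotient hker.1 huus huu
  obtain ⟨c, hc⟩ := flip_smul_of_kerDim_eq_two hU.1.continuous (hα 0) hker hrot hu₀ne hW hu₀W
  have hperiod : ∀ γ ∈ Λ, ∀ z, density u₀ (z + γ) = density u₀ z := fun γ hγ z =>
    density_add hker hγ z
  have hgN : ∀ k ∉ Λdual, g k = (weightedGram (density u₀) k).det := fun k hk => by
    rw [hg]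
    congr 1
    ext j l
    rw [hG]
    exact gram_eq_weightedGram (fun j z hz => huu j k hk z hz) j l
  set V : C(ℂ, ℂ × ℂ) := ⟨W, hW.continuous⟩
  have hV : ∃ z, pointwiseNorm V z ≠ 0 := by
    obtain ⟨z, hz⟩ := Function.ne_iff.mp hu₀ne
    refine ⟨z, pointwiseNorm_ne_zero fun h => hz ?_⟩
    rw [hu₀W]
    exact smul_eq_zero_of_right _ h
  have hVperiod : ∀ γ ∈ Λ, ∀ z, ‖stackingTheta (z + γ)‖ * pointwiseNorm V (z + γ) =
      ‖stackingTheta z‖ * pointwiseNorm V z := fun γ hγ z => by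
    rw [norm_mul_pointwiseNorm hu₀W, norm_mul_pointwiseNorm hu₀W, hperiod γ hγ]
  set L : ℂ → ℂ := fun q => ((Real.log (g q).re : ℝ) : ℂ) with hL
  have hcurv : ∀ k ∉ Λdual, (0 < (g k).re ∧ (g k).im = 0) ∧ DifferentiableAt ℝ L k ∧
      DifferentiableAt ℝ (dk L) k ∧ (dkbar (dk L) k).im = 0 ∧ 0 ≤ (dkbar (dk L) k).re :=
    fun k hk => by
      rw [hg]
      exact dkbar_dk_log_det_gram isOpen_compl_Λdual
        (a := fun j => l2Section (weightedNumer (pointwiseNorm V) j))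
        (fun j => differentiable_l2Section (differentiable_weightedNumer _ j))
        (fun k hk => linearIndependent_l2Section hV hVperiod hk)
        (fun k hk j l => (hG k j l).trans
          (gram_eq_inner (W := V) (v := fun j => uu j k) (fun j z => huuW j k hk z) j l))
        (fun k => by simp only [hL, hg]) hk
  have hsymm : ∀ (b k : ℂ) (a : ℂ → ℂ), (starRingEnd ℂ) b * b = 1 → Differentiable ℂ a →
      k ∉ Λdual → (∀ w, b * w ∈ Λdual ↔ w ∈ Λdual) →
      (∀ w ∉ Λdual, L (b * w) = L w + ((2 * (a w).re : ℝ) : ℂ)) →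
      dkbar (dk L) (b * k) = dkbar (dk L) k := by
    intro b k a hb ha hk hbΛ hLb
    have hnear : ∀ᶠ w in nhds k, w ∉ Λdual := isOpen_compl_Λdual.mem_nhds hk
    have hbk : b * k ∉ Λdual := fun h => hk ((hbΛ k).mp h)
    exact dkbar_dk_mul_eq hb ha (hnear.mono hLb) (hnear.mono fun w hw => (hcurv w hw).2.1)
      (hcurv k hk).2.2.1 (hnear.mono fun w hw => (hcurv _ fun h => hw ((hbΛ w).mp h)).2.1)
      (hcurv _ hbk).2.2.1
  intro k hk
  obtain ⟨⟨hgpos, hgim⟩, -, -, him, hre⟩ := hcurv k hk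
  have hHL : ∀ k, H k = dkbar (dk L) k := hH
  refine ⟨hgpos, hgim, by rwa [hHL], by rwa [hHL], ?_, ?_⟩
  · rw [hHL, hHL]
    refine hsymm ω k (fun w => 2 * (-Real.pi * I * ω * zmap w ^ 2)) ?_ ?_ hk
      (fun w => ω_mul_mem_Λdual_iff) fun w hw => ?_
    · rw [mul_comm, mul_conj, normSq_eq_norm_sq, norm_ω]
      simp
    · have : Differentiable ℂ zmap := by
        unfold zmap
        fun_prop
      fun_prop
    · have hgω : g (ω * w) =
          ((normSq (cexp (-Real.pi * I * ω * zmap w ^ 2)) ^ 2 : ℝ) : ℂ) * g w := by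
        rw [hgN _ fun h => hw (ω_mul_mem_Λdual_iff.mp h), hgN w hw, det_weightedGram_ω_mul hperiod
          fun z => by rw [density, density, hrot]]
      simp only [hL, hgω, re_ofReal_mul]
      rw [Real.log_mul (pow_ne_zero 2 (normSq_pos.mpr (exp_ne_zero _)).ne') (hcurv w hw).1.1.ne',
        normSq_eq_norm_sq, norm_exp, ← pow_mul, ← Real.exp_nat_mul, Real.log_exp, ← ofReal_add]
      congr 1
      simp only [re_ofNat, im_ofNat, mul_re 2]
      push_cast
      ring
  · rw [hHL, hHL]
    have := hsymm (-1) k (fun _ => 0) (by simp) (differentiable_const 0) hk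
      (fun w => by rw [neg_one_mul, neg_mem_Λdual_iff]) fun w hw => by
        have hgneg : g (-w) = g w := by
          rw [hgN _ fun h => hw (neg_mem_Λdual_iff.mp h), hgN w hw,
            det_weightedGram_neg hperiod fun z => density_neg hu₀ne hc z]
        simp [hL, hgneg]
    rwa [neg_one_mul] at this

end TBG
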